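/- arXiv:2212.02037 — 2 statements merged into one kernel-verified Lean document; each statement's English description precedes it below -/
import Mathlib

section
/- Let λ ∈ 𝒫_k, let u = A_{i_1}⋯A_{i_r} be a weak hook word with i_1 > ⋯ > i_j ≤ i_{j+1} < ⋯ < i_r with respect to I_{supp(u)}, write u = H V with H = A_{i_1}⋯A_{i_j} and V = A_{i_{j+1}}⋯A_{i_r}, and suppose u * λ = μ with μ ∈ 𝒫_k (star action on k-bounded partitions, result nonzero). Then ht(μ/λ) ≤ r − j, the weak length of V; moreover ht((V * λ)/λ) ≤ (r − j) − p, where p is the number of maximal segments of consecutive letters (with respect to I_{supp(u)}) in V. -/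
open scoped BigOperators Classical

noncomputable section

namespace MN

/-! ## Residues, words, canonical cyclic intervals -/

/-- The residues `ℤ/(k+1)ℤ`. -/
abbrev Idx (k : ℕ) := ZMod (k + 1)

/-- A word in the generators, recorded by its list of indices. -/
abbrev Word (k : ℕ) := List (Idx k)

/-- The support of a word. -/
def supp (k : ℕ) (u : Word k) : Finset (Idx k) := u.toFinset

/-- The smallest `a ∈ {0,…,k}` (as a natural number) with `(a : ℤ/(k+1)) ∉ S`. -/
def gapNat (k : ℕ) (S : Finset (Idx k)) : ℕ :=
  if h : ∃ m : ℕ, m ≤ k ∧ (m : Idx k) ∉ S then Nat.find h else 0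

/-- The gap element `a` of a proper subset `S`. -/
def gap (k : ℕ) (S : Finset (Idx k)) : Idx k := (gapNat k S : Idx k)

/-- Position of a residue `i` in the canonical cyclic interval
`I_S : a+1 < a+2 < ⋯ < k < 0 < ⋯ < a−1` (the gap `a` itself gets the junk position `k`). -/
def pos (k : ℕ) (S : Finset (Idx k)) (i : Idx k) : ℕ := (i - gap k S - 1).val

/-- The list of positions of the letters of `u` in the canonical cyclic interval of its support. -/
def posList (k : ℕ) (u : Word k) : List ℕ := u.map (pos k (supp k u))

/-- A weak hook word of hook type V:
`i₁ > ⋯ > i_j < i_{j+1} < ⋯ < i_m` with respect to `I_{supp u}`. -/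
def IsHookV (k : ℕ) (u : Word k) : Prop :=
  supp k u ≠ Finset.univ ∧
    ∃ (ds as : List ℕ) (v : ℕ),
      posList k u = ds ++ v :: as ∧
        List.Chain' (· > ·) (ds ++ [v]) ∧ List.Chain' (· < ·) (v :: as)

/-- A weak hook word of hook type U:
`i₁ > ⋯ > i_j = i_{j+1} < ⋯ < i_m` with respect to `I_{supp u}`. -/
def IsHookU (k : ℕ) (u : Word k) : Prop :=
  supp k u ≠ Finset.univ ∧
    ∃ (ds as : List ℕ) (v : ℕ),
      posList k u = ds ++ v :: v :: as ∧
        List.Chain' (· > ·) (ds ++ [v]) ∧ List.Chain' (· < ·) (v :: as)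

/-- A weak hook word. -/
def IsWeakHook (k : ℕ) (u : Word k) : Prop := IsHookV k u ∨ IsHookU k u

/-- The number of ascents `i_t < i_{t+1}` of a word. -/
def asc (k : ℕ) (u : Word k) : ℕ :=
  ((posList k u).zip (posList k u).tail).countP fun p => decide (p.1 < p.2)

/-- The candidates `c` in the definition of `u_min`: letters `c` of `u` for which there is a
letter `a` of `u` with `a < c` in `I_{supp u}`, `a + 1 ≠ c`, and no letter `b` of `u` satisfies
`a < b < c`. -/
def uminCands (k : ℕ) (u : Word k) : Finset (Idx k) :=
  (supp k u).filter fun c =>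
    ∃ a ∈ supp k u,
      pos k (supp k u) a < pos k (supp k u) c ∧ a + 1 ≠ c ∧
        ∀ b ∈ supp k u,
          ¬(pos k (supp k u) a < pos k (supp k u) b ∧
            pos k (supp k u) b < pos k (supp k u) c)

/-- The letter `u_min` of `u` (junk value `0` if there is no candidate). -/
def umin (k : ℕ) (u : Word k) : Idx k :=
  if h : (uminCands k u).Nonempty then
    ((uminCands k u).exists_min_image (pos k (supp k u)) h).choose
  else 0

/-- The number of occurrences of `u_min` in `u` (`0` if there is no candidate). -/
def uminCount (k : ℕ) (u : Word k) : ℕ :=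
  if (uminCands k u).Nonempty then u.count (umin k u) else 0

/-- A set of residues is `k`-connected if it is a proper subset of `{0,…,k}` which is an
interval with respect to its canonical cyclic interval order. -/
def IsKConnectedSet (k : ℕ) (S : Finset (Idx k)) : Prop :=
  S ≠ Finset.univ ∧
    ∀ i ∈ S, ∀ j ∈ S, ∀ m : Idx k,
      pos k S i ≤ pos k S m → pos k S m ≤ pos k S j → m ∈ S

/-- A word is `k`-connected if its support is. -/
def IsKConnected (k : ℕ) (u : Word k) : Prop := IsKConnectedSet k (supp k u)

/-- A word is `k`-weak connected if `u_min` occurs `0` or `2` times in it. -/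
def IsWeakConnected (k : ℕ) (u : Word k) : Prop :=
  uminCount k u = 0 ∨ uminCount k u = 2

/-- The letter `c` lies on the left side (the maximal strictly decreasing initial segment) of
the hook form of `u`: equivalently, it occurs in some strictly decreasing initial segment. -/
def OnLeftSide (k : ℕ) (u : Word k) (c : Idx k) : Prop :=
  ∃ p q : Word k, u = p ++ q ∧
    List.Chain' (fun a b => pos k (supp k u) b < pos k (supp k u) a) p ∧ c ∈ p

/-- The letter `c` lies on the right side (the maximal strictly increasing final segment) of
the hook form of `u`. -/
def OnRightSide (k : ℕ) (u : Word k) (c : Idx k) : Prop :=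
  ∃ p q : Word k, u = p ++ q ∧
    List.Chain' (fun a b => pos k (supp k u) a < pos k (supp k u) b) q ∧ c ∈ q

/-! ## The sets `X^r_i` and their refinements (indexed by `i : ℤ`, empty for `i < 0`) -/

/-- `V^r_i`: weak hook words of hook type V, weak length `r`, `asc = i`. -/
def VSet (k r : ℕ) (i : ℤ) : Set (Word k) :=
  {u | IsHookV k u ∧ u.length = r ∧ (asc k u : ℤ) = i}

/-- `U^r_i`. -/
def USet (k r : ℕ) (i : ℤ) : Set (Word k) :=
  {u | IsHookU k u ∧ u.length = r ∧ (asc k u : ℤ) = i}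

/-- `V^r_{i,wc}`: the `k`-weak connected members of `V^r_i`. -/
def VSetWC (k r : ℕ) (i : ℤ) : Set (Word k) := {u ∈ VSet k r i | IsWeakConnected k u}

/-- `U^r_{i,wc}`. -/
def USetWC (k r : ℕ) (i : ℤ) : Set (Word k) := {u ∈ USet k r i | IsWeakConnected k u}

/-- `V^r_{i,c}`: the `k`-connected members of `V^r_i`. -/
def VSetC (k r : ℕ) (i : ℤ) : Set (Word k) := {u ∈ VSet k r i | IsKConnected k u}

/-- `V^r_{i,w̄c,left}`. -/
def VSetNWCL (k r : ℕ) (i : ℤ) : Set (Word k) :=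
  {u ∈ VSet k r i | ¬IsWeakConnected k u ∧ OnLeftSide k u (umin k u)}

/-- `V^r_{i,w̄c,right}`. -/
def VSetNWCR (k r : ℕ) (i : ℤ) : Set (Word k) :=
  {u ∈ VSet k r i | ¬IsWeakConnected k u ∧ OnRightSide k u (umin k u)}

/-- `U^r_{i,w̄c,left}`. -/
def USetNWCL (k r : ℕ) (i : ℤ) : Set (Word k) :=
  {u ∈ USet k r i | ¬IsWeakConnected k u ∧ OnLeftSide k u (umin k u)}

/-- `U^r_{i,w̄c,right}`. -/
def USetNWCR (k r : ℕ) (i : ℤ) : Set (Word k) :=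
  {u ∈ USet k r i | ¬IsWeakConnected k u ∧ OnRightSide k u (umin k u)}

/-! ## The algebras `𝒜_k`, `ℋ_k`, `𝒩_k` -/

/-- The defining relations of `𝒜_k`. -/
inductive AkRel (k : ℕ) : FreeAlgebra ℤ (Idx k) → FreeAlgebra ℤ (Idx k) → Prop
  | braid (i : Idx k) :
      AkRel k (FreeAlgebra.ι ℤ i * FreeAlgebra.ι ℤ (i + 1) * FreeAlgebra.ι ℤ i)
        (FreeAlgebra.ι ℤ (i + 1) * FreeAlgebra.ι ℤ i * FreeAlgebra.ι ℤ (i + 1))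
  | comm (i j : Idx k) (h1 : i - j ≠ 1) (h2 : j - i ≠ 1) :
      AkRel k (FreeAlgebra.ι ℤ i * FreeAlgebra.ι ℤ j)
        (FreeAlgebra.ι ℤ j * FreeAlgebra.ι ℤ i)

/-- The algebra `𝒜_k`. -/
abbrev Ak (k : ℕ) := RingQuot (AkRel k)

/-- The generator `A_i` of `𝒜_k`. -/
def Agen (k : ℕ) (i : Idx k) : Ak k := RingQuot.mkAlgHom ℤ (AkRel k) (FreeAlgebra.ι ℤ i)

/-- The element `A_{i₁} ⋯ A_{i_m}` of `𝒜_k` associated to a word. -/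
def Aword (k : ℕ) (u : Word k) : Ak k := (u.map (Agen k)).prod

/-- The defining relations of the 0-Hecke algebra `ℋ_k`. -/
inductive HkRel (k : ℕ) : FreeAlgebra ℤ (Idx k) → FreeAlgebra ℤ (Idx k) → Prop
  | braid (i : Idx k) :
      HkRel k (FreeAlgebra.ι ℤ i * FreeAlgebra.ι ℤ (i + 1) * FreeAlgebra.ι ℤ i)
        (FreeAlgebra.ι ℤ (i + 1) * FreeAlgebra.ι ℤ i * FreeAlgebra.ι ℤ (i + 1))
  | comm (i j : Idx k) (h1 : i - j ≠ 1) (h2 : j - i ≠ 1) :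
      HkRel k (FreeAlgebra.ι ℤ i * FreeAlgebra.ι ℤ j)
        (FreeAlgebra.ι ℤ j * FreeAlgebra.ι ℤ i)
  | sq (i : Idx k) :
      HkRel k (FreeAlgebra.ι ℤ i * FreeAlgebra.ι ℤ i) (-(FreeAlgebra.ι ℤ i))

/-- The 0-Hecke algebra `ℋ_k`. -/
abbrev Hk (k : ℕ) := RingQuot (HkRel k)

/-- The generator `H_i`. -/
def Hgen (k : ℕ) (i : Idx k) : Hk k := RingQuot.mkAlgHom ℤ (HkRel k) (FreeAlgebra.ι ℤ i)

/-- The element `H_{i₁} ⋯ H_{i_m}`. -/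
def Hword (k : ℕ) (u : Word k) : Hk k := (u.map (Hgen k)).prod

/-- The defining relations of the nilCoxeter algebra `𝒩_k`. -/
inductive NkRel (k : ℕ) : FreeAlgebra ℤ (Idx k) → FreeAlgebra ℤ (Idx k) → Prop
  | braid (i : Idx k) :
      NkRel k (FreeAlgebra.ι ℤ i * FreeAlgebra.ι ℤ (i + 1) * FreeAlgebra.ι ℤ i)
        (FreeAlgebra.ι ℤ (i + 1) * FreeAlgebra.ι ℤ i * FreeAlgebra.ι ℤ (i + 1))
  | comm (i j : Idx k) (h1 : i - j ≠ 1) (h2 : j - i ≠ 1) :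
      NkRel k (FreeAlgebra.ι ℤ i * FreeAlgebra.ι ℤ j)
        (FreeAlgebra.ι ℤ j * FreeAlgebra.ι ℤ i)
  | sq (i : Idx k) :
      NkRel k (FreeAlgebra.ι ℤ i * FreeAlgebra.ι ℤ i) 0

/-- The nilCoxeter algebra `𝒩_k`. -/
abbrev Nk (k : ℕ) := RingQuot (NkRel k)

/-- The generator `N_i`. -/
def Ngen (k : ℕ) (i : Idx k) : Nk k := RingQuot.mkAlgHom ℤ (NkRel k) (FreeAlgebra.ι ℤ i)

/-- The element `N_{i₁} ⋯ N_{i_m}`. -/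
def Nword (k : ℕ) (u : Word k) : Nk k := (u.map (Ngen k)).prod

/-! ## The affine symmetric group -/

/-- The relators of the affine symmetric group `S̃_{k+1}`. -/
def CoxRels (k : ℕ) : Set (FreeGroup (Idx k)) :=
  {g | (∃ i : Idx k, g = FreeGroup.of i * FreeGroup.of i) ∨
    (∃ i : Idx k,
      g = FreeGroup.of i * FreeGroup.of (i + 1) * FreeGroup.of i *
        (FreeGroup.of (i + 1) * FreeGroup.of i * FreeGroup.of (i + 1))⁻¹) ∨
    (∃ i j : Idx k, i - j ≠ 1 ∧ j - i ≠ 1 ∧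
      g = FreeGroup.of i * FreeGroup.of j * (FreeGroup.of j * FreeGroup.of i)⁻¹)}

/-- The affine symmetric group `S̃_{k+1}`. -/
abbrev AffS (k : ℕ) := PresentedGroup (CoxRels k)

/-- The generator `s_i`. -/
def sgen (k : ℕ) (i : Idx k) : AffS k := PresentedGroup.of i

/-- The product `s_{i₁} ⋯ s_{i_m}`. -/
def sword (k : ℕ) (u : Word k) : AffS k := (u.map (sgen k)).prod

/-- The Coxeter length of `w ∈ S̃_{k+1}`. -/
def len (k : ℕ) (w : AffS k) : ℕ :=
  sInf {m | ∃ u : Word k, u.length = m ∧ sword k u = w}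

/-- `u` is a reduced word. -/
def IsReducedWord (k : ℕ) (u : Word k) : Prop := len k (sword k u) = u.length

/-- The finite symmetric group `S_{k+1} = ⟨s_1, …, s_k⟩` inside `S̃_{k+1}`. -/
def FinSub (k : ℕ) : Subgroup (AffS k) :=
  Subgroup.closure {g | ∃ i : Idx k, i ≠ 0 ∧ g = sgen k i}

/-- `w` is a minimal-length coset representative of `S̃_{k+1}/S_{k+1}` (a Grassmannian
element). -/
def IsGrassmannian (k : ℕ) (w : AffS k) : Prop :=
  ∀ v : AffS k, w⁻¹ * v ∈ FinSub k → len k w ≤ len k v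

/-! ## Anti-weak hook words -/

/-- Anti-weak hook word, first form: `i₁ < ⋯ < i_j > i_{j+1} > ⋯ > i_m`. -/
def IsAntiHookV (k : ℕ) (u : Word k) : Prop :=
  supp k u ≠ Finset.univ ∧
    ∃ (ds as : List ℕ) (v : ℕ),
      posList k u = ds ++ v :: as ∧
        List.Chain' (· < ·) (ds ++ [v]) ∧ List.Chain' (· > ·) (v :: as)

/-- Anti-weak hook word, second form: `i₁ < ⋯ < i_j = i_{j+1} > ⋯ > i_m`. -/
def IsAntiHookU (k : ℕ) (u : Word k) : Prop :=
  supp k u ≠ Finset.univ ∧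
    ∃ (ds as : List ℕ) (v : ℕ),
      posList k u = ds ++ v :: v :: as ∧
        List.Chain' (· < ·) (ds ++ [v]) ∧ List.Chain' (· > ·) (v :: as)

/-- Anti-weak hook word. -/
def IsAntiWeakHook (k : ℕ) (u : Word k) : Prop := IsAntiHookV k u ∨ IsAntiHookU k u

/-- Length of the maximal strictly increasing (w.r.t. `I_{supp u}`) initial segment of `u`
(= the left side of an anti-weak hook word). -/
def incPrefixLen (k : ℕ) (u : Word k) : ℕ :=
  sSup {n | n ≤ u.length ∧
    List.Chain' (fun a b => pos k (supp k u) a < pos k (supp k u) b) (u.take n)}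

/-- Length of the maximal strictly increasing (w.r.t. `I_{supp u}`) final segment of `u`
(= the right side of a weak hook word). -/
def incSuffixLen (k : ℕ) (u : Word k) : ℕ :=
  sSup {n | n ≤ u.length ∧
    List.Chain' (fun a b => pos k (supp k u) a < pos k (supp k u) b)
      (u.drop (u.length - n))}

/-! ## Noncommutative symmetric functions in `𝒜_k` -/

/-- The word underlying the cyclically decreasing element `d_A` (letters of `A` in decreasing
position order, so that `A_{i+1}` occurs before `A_i` whenever `i, i+1 ∈ A`). -/
def dwordOf (k : ℕ) (A : Finset (Idx k)) : Word k :=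
  (((A.image (pos k A)).sort (· ≤ ·)).reverse).map fun n => gap k A + 1 + (n : Idx k)

/-- The word underlying the cyclically increasing element `i_A`. -/
def iwordOf (k : ℕ) (A : Finset (Idx k)) : Word k :=
  ((A.image (pos k A)).sort (· ≤ ·)).map fun n => gap k A + 1 + (n : Idx k)

/-- The noncommutative homogeneous symmetric function `h_r = Σ_{|A| = r} d_A`. -/
def hFun (k r : ℕ) : Ak k :=
  ∑ A ∈ Finset.powersetCard r (Finset.univ : Finset (Idx k)), Aword k (dwordOf k A)

/-- The noncommutative elementary symmetric function `e_r = Σ_{|A| = r} i_A`. -/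
def eFun (k r : ℕ) : Ak k :=
  ∑ A ∈ Finset.powersetCard r (Finset.univ : Finset (Idx k)), Aword k (iwordOf k A)

/-- The noncommutative hook Schur function `s_{(r−i,1^i)}`. -/
def sHookFun (k r i : ℕ) : Ak k :=
  ∑ j ∈ Finset.range (i + 1), ((-1 : ℤ) ^ j) • (hFun k (r - i + j) * eFun k (i - j))

/-- The noncommutative power sum `p_r`. -/
def pFun (k r : ℕ) : Ak k :=
  ∑ i ∈ Finset.range r, ((-1 : ℤ) ^ i) • sHookFun k r i

/-! ## Actions on the affine symmetric group -/

/-- The star action of a generator: `A_i * w = s_i w` if `l(s_i w) > l(w)`, else `w`. -/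
def starG (k : ℕ) (i : Idx k) (w : AffS k) : AffS k :=
  if len k w < len k (sgen k i * w) then sgen k i * w else w

/-- The star action of a word: `A_{i₁}⋯A_{i_m} * w = A_{i₁} * (⋯ * (A_{i_m} * w))`. -/
def starW (k : ℕ) (u : Word k) (w : AffS k) : AffS k := u.foldr (starG k) w

/-- The dot action of a generator, with values in `S̃_{k+1} ∪ {0}`. -/
def dotG (k : ℕ) (i : Idx k) : Option (AffS k) → Option (AffS k)
  | none => none
  | some w => if len k w < len k (sgen k i * w) then some (sgen k i * w) else none

/-- The dot action of a word. -/
def dotW (k : ℕ) (u : Word k) (o : Option (AffS k)) : Option (AffS k) :=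
  u.foldr (dotG k) o

/-- Extension of an action datum `act : generator → S̃ → S̃ ∪ {0}` to `S̃ ∪ {0}`. -/
def actExt (k : ℕ) (act : Idx k → AffS k → Option (AffS k)) (i : Idx k) :
    Option (AffS k) → Option (AffS k)
  | none => none
  | some w => act i w

/-- Extension of an action datum to words. -/
def actW (k : ℕ) (act : Idx k → AffS k → Option (AffS k)) (u : Word k)
    (o : Option (AffS k)) : Option (AffS k) :=
  u.foldr (actExt k act) o

/-! ## Rings and coefficients -/

/-- `(−1)^n` for an integer exponent `n`, in any ring. -/
def msign (R : Type*) [Ring R] (n : ℤ) : R := (((-1 : Rˣ) ^ n : Rˣ) : R)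

/-- The power sum `p^R_r = Σ_{i=0}^{r−1} Σ_{j=0}^{i} (−1)^{i+j} h^R_{r−i+j} e^R_{i−j}` built from
Pieri data in a commutative ring. -/
def pR {R : Type*} [CommRing R] (h e : ℕ → R) (r : ℕ) : R :=
  ∑ i ∈ Finset.range r, ∑ j ∈ Finset.range (i + 1),
    ((-1 : ℤ) ^ (i + j)) • (h (r - i + j) * e (i - j))

/-- The integer coefficient
`Σ_{i=0}^{r−1} (−1)^i |V^r_{i,wc} ∩ P| + Σ_{i=1}^{r−1} (−1)^i (r−i) |U^r_{i−1,wc} ∩ P|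
 + Σ_{i=1}^{r−2} (−1)^i |U^r_{i−1,w̄c,left} ∩ P|`. -/
def MNcoeff (k r : ℕ) (P : Word k → Prop) : ℤ :=
  (∑ i ∈ Finset.range r, (-1 : ℤ) ^ i * ({u ∈ VSetWC k r (i : ℤ) | P u}.ncard : ℤ)) +
    (∑ i ∈ Finset.Icc 1 (r - 1),
      (-1 : ℤ) ^ i * ((r : ℤ) - i) * ({u ∈ USetWC k r ((i : ℤ) - 1) | P u}.ncard : ℤ)) +
    ∑ i ∈ Finset.Icc 1 (r - 2),
      (-1 : ℤ) ^ i * ({u ∈ USetNWCL k r ((i : ℤ) - 1) | P u}.ncard : ℤ)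

/-- The integer coefficient `Σ_{i=0}^{r−1} (−1)^i |V^r_{i,c} ∩ P|`. -/
def kcoeff (k r : ℕ) (P : Word k → Prop) : ℤ :=
  ∑ i ∈ Finset.range r, (-1 : ℤ) ^ i * ({u ∈ VSetC k r (i : ℤ) | P u}.ncard : ℤ)

/-! ## Partitions, cores, bounded partitions -/

/-- A cell of a Young diagram: (row, column), `0`-indexed. -/
abbrev Cell := ℕ × ℕ

/-- A (finite) Young diagram, as a finite lower set of cells. -/
def IsYoung (S : Set Cell) : Prop :=
  S.Finite ∧ ∀ p ∈ S, ∀ q : Cell, q.1 ≤ p.1 → q.2 ≤ p.2 → q ∈ S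

/-- The `(k+1)`-residue of a cell `(i,j)`, i.e. `j − i mod (k+1)`. -/
def res (k : ℕ) (c : Cell) : Idx k := (c.2 : Idx k) - (c.1 : Idx k)

/-- The hook length of a cell: arm + leg + 1. -/
def hookLen (S : Set Cell) (c : Cell) : ℕ :=
  {j | c.2 < j ∧ (c.1, j) ∈ S}.ncard + {i | c.1 < i ∧ (i, c.2) ∈ S}.ncard + 1

/-- A `(k+1)`-core: a partition with no cell of hook length `k+1`. -/
def IsCore (k : ℕ) (S : Set Cell) : Prop :=
  IsYoung S ∧ ∀ c ∈ S, hookLen S c ≠ k + 1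

/-- A `k`-bounded partition: every part is at most `k`. -/
def IsBounded (k : ℕ) (S : Set Cell) : Prop :=
  IsYoung S ∧ ∀ c ∈ S, c.2 < k

/-- A removable corner of `S`. -/
def Removable (S : Set Cell) (c : Cell) : Prop :=
  c ∈ S ∧ (c.1 + 1, c.2) ∉ S ∧ (c.1, c.2 + 1) ∉ S

/-- An addable corner of `S`: a cell not in `S` whose addition yields a partition. -/
def Addable (S : Set Cell) (c : Cell) : Prop :=
  c ∉ S ∧ IsYoung (S ∪ {c})

/-- The map `𝔭` from `(k+1)`-cores to `k`-bounded partitions: row `i` of `𝔭(κ)` has as many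
cells as there are cells of hook length at most `k` in row `i` of `κ`. -/
def pMap (k : ℕ) (S : Set Cell) : Set Cell :=
  {c | c.2 < {j | (c.1, j) ∈ S ∧ hookLen S (c.1, j) ≤ k}.ncard}

/-- The inverse bijection `𝔭^{-1}` from `k`-bounded partitions to `(k+1)`-cores. -/
def pInv (k : ℕ) (lam : Set Cell) : Set Cell :=
  Function.invFunOn (pMap k) {S | IsCore k S} lam

/-- The transpose (conjugate) of a diagram. -/
def transposeSet (S : Set Cell) : Set Cell := {c | (c.2, c.1) ∈ S}

/-- The `k`-conjugate `λ^{(k)} = 𝔭((𝔭^{-1} λ)^t)`. -/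
def kconj (k : ℕ) (lam : Set Cell) : Set Cell := pMap k (transposeSet (pInv k lam))

/-- A skew shape is a ribbon if it contains no `2×2` square. -/
def IsRibbon (D : Set Cell) : Prop :=
  ∀ c : Cell, ¬((c.1, c.2) ∈ D ∧ (c.1 + 1, c.2) ∈ D ∧
    (c.1, c.2 + 1) ∈ D ∧ (c.1 + 1, c.2 + 1) ∈ D)

/-- A vertical strip: no two cells in the same row. -/
def IsVStrip (D : Set Cell) : Prop :=
  ∀ c ∈ D, ∀ c' ∈ D, c.1 = c'.1 → c = c'

/-- A horizontal strip: no two cells in the same column. -/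
def IsHStrip (D : Set Cell) : Prop :=
  ∀ c ∈ D, ∀ c' ∈ D, c.2 = c'.2 → c = c'

/-- The height of a skew shape: the number of occupied rows minus the number of connected
components; each connected component is counted by its unique last occupied row, i.e. an
occupied row sharing no column with the next row. -/
def htSkew (D : Set Cell) : ℕ :=
  {i : ℕ | ∃ j, (i, j) ∈ D}.ncard -
    {i : ℕ | (∃ j, (i, j) ∈ D) ∧ ¬∃ j, (i, j) ∈ D ∧ (i + 1, j) ∈ D}.ncard

/-- The set of `(k+1)`-residues of the cells of a skew shape. -/
def residSupp (k : ℕ) (D : Set Cell) : Finset (Idx k) :=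
  Set.Finite.toFinset (Set.toFinite (res k '' D))

/-! ## Star and dot actions on cores and on `k`-bounded partitions -/

/-- The star action of `A_i` on `(k+1)`-cores together with `0`. -/
def starC (k : ℕ) (i : Idx k) : Option (Set Cell) → Option (Set Cell)
  | none => none
  | some S =>
    if ∃ c, Addable S c ∧ res k c = i then some (S ∪ {c | Addable S c ∧ res k c = i})
    else if ∃ c, Removable S c ∧ res k c = i then some S
    else none

/-- The star action of a word on cores. -/
def starCW (k : ℕ) (u : Word k) (o : Option (Set Cell)) : Option (Set Cell) :=
  u.foldr (starC k) o

/-- The star action of a word on `k`-bounded partitions, transported through `𝔭`. -/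
def starB (k : ℕ) (u : Word k) (lam : Set Cell) : Option (Set Cell) :=
  (starCW k u (some (pInv k lam))).map (pMap k)

/-- The dot action of `A_i` on `(k+1)`-cores together with `0`. -/
def dotC (k : ℕ) (i : Idx k) : Option (Set Cell) → Option (Set Cell)
  | none => none
  | some S =>
    if ∃ c, Addable S c ∧ res k c = i then some (S ∪ {c | Addable S c ∧ res k c = i})
    else none

/-- The dot action of a word on cores. -/
def dotCW (k : ℕ) (u : Word k) (o : Option (Set Cell)) : Option (Set Cell) :=
  u.foldr (dotC k) o

/-- The dot action of a word on `k`-bounded partitions, transported through `𝔭`. -/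
def dotB (k : ℕ) (u : Word k) (lam : Set Cell) : Option (Set Cell) :=
  (dotCW k u (some (pInv k lam))).map (pMap k)

/-- The number of maximal segments of consecutive letters (w.r.t. the positions for `S`) of a
word `V`. -/
def numSegments (k : ℕ) (S : Finset (Idx k)) (V : Word k) : ℕ :=
  if V.length = 0 then 0
  else ((V.zip V.tail).countP fun p => decide (pos k S p.2 ≠ pos k S p.1 + 1)) + 1

/-- Conditions (K0)–(K4) of the Murnaghan–Nakayama rule for `K`-`k`-Schur functions. -/
def Kconds (k r : ℕ) (lam mu : Set Cell) : Prop :=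
  lam ⊆ mu ∧ kconj k lam ⊆ kconj k mu ∧
    (mu \ lam).ncard ≤ r ∧
    IsRibbon (pInv k mu \ pInv k lam) ∧
    (IsKConnectedSet k (residSupp k (pInv k mu \ pInv k lam)) ∨
      (residSupp k (pInv k mu \ pInv k lam)).card < r) ∧
    htSkew (mu \ lam) + htSkew (kconj k mu \ kconj k lam) < r

/-- Conditions (k0)–(k4) of the Murnaghan–Nakayama rule for `k`-Schur functions. -/
def kconds (k r : ℕ) (lam mu : Set Cell) : Prop :=
  lam ⊆ mu ∧ kconj k lam ⊆ kconj k mu ∧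
    (mu \ lam).ncard = r ∧
    IsRibbon (pInv k mu \ pInv k lam) ∧
    IsKConnectedSet k (residSupp k (pInv k mu \ pInv k lam)) ∧
    htSkew (mu \ lam) + htSkew (kconj k mu \ kconj k lam) = r - 1


/-! ## Proof -/

lemma zwin (k : ℕ) (a b : ℤ) (h : (a : ZMod (k+1)) = (b : ZMod (k+1))) (hab : a < b) :
    a + (k + 1) ≤ b := by
  have h1 := (ZMod.intCast_eq_intCast_iff_dvd_sub a b (k+1)).1 h
  have := Int.le_of_dvd (by omega) h1
  push_cast at this
  omega

lemma zrep (k : ℕ) (x : ℤ) (d : ZMod (k+1)) :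
    ∃ g : ℤ, x ≤ g ∧ g < x + (k + 1) ∧ (g : ZMod (k+1)) = d := by
  refine ⟨x + (d - (x : ZMod (k+1))).val, by omega, ?_, ?_⟩
  · have := ZMod.val_lt (d - (x : ZMod (k+1)))
    omega
  · push_cast
    rw [ZMod.natCast_zmod_val]
    ring

lemma one_ne (k : ℕ) (hk : 1 ≤ k) (c : ZMod (k+1)) : c + 1 ≠ c := by
  have : Fact (1 < k+1) := ⟨by omega⟩
  simp

/-- abacus representation -/
structure Rep (k : ℕ) (S : Set Cell) (r : ℕ → ℕ) (m : ZMod (k+1) → ℤ) : Prop where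
  mem : ∀ i j, (i, j) ∈ S ↔ j < r i
  anti : ∀ i, r (i+1) ≤ r i
  fin : ∃ N, ∀ i, N ≤ i → r i = 0
  cls : ∀ d, ((m d : ℤ) : ZMod (k+1)) = d
  bead : ∀ b : ℤ, (∃ i : ℕ, (r i : ℤ) - i = b) ↔ b ≤ m (b : ZMod (k+1))

def rk (k : ℕ) (m : ZMod (k+1) → ℤ) (x : ℤ) : ℕ := {d | m d < x}.ncard

lemma rk_mono (k : ℕ) (m : ZMod (k+1) → ℤ) {x y : ℤ} (h : x ≤ y) : rk k m x ≤ rk k m y :=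
  Set.ncard_le_ncard (fun d hd => lt_of_lt_of_le hd h) (Set.toFinite _)

lemma rk_lt (k : ℕ) (m : ZMod (k+1) → ℤ) {y : ℤ} (d) (h : m d < y) :
    rk k m (m d) < rk k m y :=
  Set.ncard_lt_ncard ⟨fun e he => lt_trans he h, fun h' => lt_irrefl (m d) (h' h)⟩ (Set.toFinite _)

lemma Rep.le_anti {k S r m} (h : Rep k S r m) {i j : ℕ} (hij : i ≤ j) : r j ≤ r i :=
  (antitone_nat_of_succ_le h.anti) hij

/-- column data -/
lemma Rep.col {k S r m} (h : Rep k S r m) : ∃ c : ℕ → ℕ, ∀ i j, i < c j ↔ j < r i := by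
  obtain ⟨N, hN⟩ := h.fin
  have : ∀ j, ∃ i, ¬ j < r i := fun j => ⟨N, by rw [hN N le_rfl]; omega⟩
  refine ⟨fun j => Nat.find (this j), fun i j => ?_⟩
  rw [Nat.lt_find_iff]
  constructor
  · intro h'
    exact not_not.1 (h' i le_rfl)
  · intro h' p hp
    have := h.le_anti hp
    omega

lemma young_rows {S : Set Cell} (hS : IsYoung S) :
    ∃ r : ℕ → ℕ, (∀ i j, (i, j) ∈ S ↔ j < r i) ∧ (∀ i, r (i+1) ≤ r i) ∧
      ∃ N, ∀ i, N ≤ i → r i = 0 := by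
  obtain ⟨hf, hl⟩ := hS
  obtain ⟨M, hM⟩ := (hf.image Prod.snd).bddAbove
  obtain ⟨N, hN⟩ := (hf.image Prod.fst).bddAbove
  have ex : ∀ i, ∃ j, (i, j) ∉ S := fun i => ⟨M+1, fun h => by
    have := hM ⟨_, h, rfl⟩
    simp at this⟩
  have key : ∀ i j, (i, j) ∈ S ↔ j < Nat.find (ex i) := by
    intro i j
    rw [Nat.lt_find_iff]
    constructor
    · intro h q hq h'
      exact h' (hl _ h _ le_rfl hq)
    · intro h
      exact not_not.1 (h j le_rfl)
  refine ⟨fun i => Nat.find (ex i), key, ?_, N+1, ?_⟩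
  · intro i
    by_contra hlt
    push Not at hlt
    have h1 := (key (i+1) _).2 hlt
    have h2 := hl _ h1 (i, Nat.find (ex i)) (by simp) le_rfl
    exact Nat.find_spec (ex i) h2
  · intro i hi
    by_contra h0
    have h1 := (key i 0).2 (Nat.pos_of_ne_zero h0)
    have := hN ⟨_, h1, rfl⟩
    simp at this
    omega

lemma hook_eq {S : Set Cell} {r c : ℕ → ℕ} (hr : ∀ i j, (i, j) ∈ S ↔ j < r i)
    (hc : ∀ i j, i < c j ↔ j < r i) (i j : ℕ) (hij : (i, j) ∈ S) :
    (hookLen S (i, j) : ℤ) = ((r i : ℤ) - i) - ((j : ℤ) - c j + 1) := by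
  have h1 : {j' | j < j' ∧ (i, j') ∈ S} = ↑(Finset.Ioo j (r i)) := by
    ext x; simp [hr]
  have h2 : {i' | i < i' ∧ (i', j) ∈ S} = ↑(Finset.Ioo i (c j)) := by
    ext x; simp [hr, hc]
  unfold hookLen
  simp only
  rw [h1, h2, Set.ncard_coe_finset, Set.ncard_coe_finset, Nat.card_Ioo, Nat.card_Ioo]
  have h3 := (hr i j).1 hij
  have h4 := (hc i j).2 h3
  omega

/-- every integer is a bead or a gap -/
lemma bead_or_gap {r c : ℕ → ℕ} (hr : ∀ i, r (i+1) ≤ r i)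
    (hc : ∀ i j, i < c j ↔ j < r i) (hN : ∃ N, ∀ i, N ≤ i → r i = 0) (b : ℤ) :
    (∃ i : ℕ, (r i : ℤ) - i = b) ∨ ∃ j : ℕ, (j : ℤ) - c j + 1 = b := by
  by_cases hb : ∃ i : ℕ, (r i : ℤ) - i = b
  · exact Or.inl hb
  right
  push Not at hb
  obtain ⟨N, hN⟩ := hN
  have ex : ∃ i : ℕ, (r i : ℤ) - i < b := by
    refine ⟨N + (1 - b).toNat, ?_⟩
    rw [hN _ (by omega)]
    push_cast
    omega
  classical
  set i := Nat.find ex with hi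
  have h1 := Nat.find_spec ex
  rw [← hi] at h1
  refine ⟨(b + i - 1).toNat, ?_⟩
  have hj : ((b + i - 1).toNat : ℤ) = b + i - 1 := by omega
  have hcj : c (b + i - 1).toNat = i := by
    apply le_antisymm
    · by_contra hlt
      push Not at hlt
      have := (hc _ _).1 hlt
      omega
    · by_contra hlt
      push Not at hlt
      have hm := Nat.find_min ex hlt
      have h2 := (hc (c (b + i - 1).toNat) (b + i - 1).toNat).not.1 (lt_irrefl _)
      have h3 := hb (c (b + i - 1).toNat)
      -- the row i-1
      obtain ⟨p, hp⟩ : ∃ p, i = p + 1 := ⟨i - 1, by omega⟩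
      have hm' := Nat.find_min ex (show p < Nat.find ex by omega)
      have h3' := hb p
      have h5 := antitone_nat_of_succ_le hr (show c (b + i - 1).toNat ≤ p by omega)
      omega
  rw [hcj]
  omega

lemma bead_ne_gap {r c : ℕ → ℕ} (hc : ∀ i j, i < c j ↔ j < r i) (i j : ℕ) :
    (j < r i ↔ (j : ℤ) - c j + 1 < (r i : ℤ) - i) ∧ (j : ℤ) - c j + 1 ≠ (r i : ℤ) - i := by
  have := hc i j
  by_cases h : j < r i
  · have h2 := this.2 h
    constructor
    · constructor <;> intro <;> omega
    · omega
  · have h2 := this.not.2 h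
    constructor
    · constructor <;> intro <;> omega
    · omega

lemma core_rep (k : ℕ) {S : Set Cell} (hS : IsCore k S) : ∃ r m, Rep k S r m := by
  obtain ⟨hY, hcore⟩ := hS
  obtain ⟨r, hmem, hanti, hfin⟩ := young_rows hY
  have hcol : ∃ c : ℕ → ℕ, ∀ i j, i < c j ↔ j < r i := by
    obtain ⟨N, hN⟩ := hfin
    have : ∀ j, ∃ i, ¬ j < r i := fun j => ⟨N, by rw [hN N le_rfl]; omega⟩
    refine ⟨fun j => Nat.find (this j), fun i j => ?_⟩
    rw [Nat.lt_find_iff]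
    constructor
    · intro h'
      exact not_not.1 (h' i le_rfl)
    · intro h' p hp
      have := antitone_nat_of_succ_le hanti hp
      omega
  obtain ⟨c, hc⟩ := hcol
  have closed : ∀ b : ℤ, (∃ i : ℕ, (r i : ℤ) - i = b) →
      ∃ i : ℕ, (r i : ℤ) - i = b - (k+1) := by
    rintro b ⟨i, hi⟩
    rcases bead_or_gap hanti hc hfin (b - (k+1)) with h | ⟨j, hj⟩
    · exact h
    · exfalso
      have h1 := (bead_ne_gap hc i j).1.2 (by omega)
      have h2 := (hmem i j).2 h1
      have h3 := hook_eq hmem hc i j h2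
      have h4 := hcore _ h2
      omega
  have closedq : ∀ (q : ℕ) (b : ℤ), (∃ i : ℕ, (r i : ℤ) - i = b) →
      ∃ i : ℕ, (r i : ℤ) - i = b - q * (k+1) := by
    intro q
    induction q with
    | zero => intro b hb; simpa using hb
    | succ q ih =>
      intro b hb
      have := closed _ (ih b hb)
      push_cast
      rw [show b - ((q:ℤ)+1) * (k+1) = b - q * (k+1) - (k+1) by ring]
      exact this
  have hex : ∀ d : ZMod (k+1), ∃ x : ℤ, ((∃ i : ℕ, (r i : ℤ) - i = x) ∧ (x : ZMod (k+1)) = d) ∧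
      ∀ y : ℤ, ((∃ i : ℕ, (r i : ℤ) - i = y) ∧ (y : ZMod (k+1)) = d) → y ≤ x := by
    intro d
    apply Int.exists_greatest_of_bdd
    · refine ⟨r 0, ?_⟩
      rintro z ⟨⟨i, hi⟩, -⟩
      have := antitone_nat_of_succ_le hanti (Nat.zero_le i)
      omega
    · obtain ⟨N, hN⟩ := hfin
      obtain ⟨g, hg1, hg2, hg3⟩ := zrep k (-(N:ℤ) - (k+1)) d
      refine ⟨g, ⟨(-g).toNat, ?_⟩, hg3⟩
      rw [hN _ (by omega)]
      omega
  choose m hm1 hm2 using hex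
  refine ⟨r, m, hmem, hanti, hfin, fun d => (hm1 d).2, fun b => ⟨fun h => hm2 _ _ ⟨h, rfl⟩, ?_⟩⟩
  intro hle
  have h1 := (hm1 (b : ZMod (k+1))).2
  have h2 := (ZMod.intCast_eq_intCast_iff_dvd_sub b _ (k+1)).1 h1.symm
  obtain ⟨q, hq⟩ := h2
  push_cast at hq
  have hq0 : 0 ≤ q := by
    by_contra hneg
    push Not at hneg
    have : ((k:ℤ)+1) * q < 0 := mul_neg_of_pos_of_neg (by omega) hneg
    omega
  obtain ⟨q', rfl⟩ := Int.eq_ofNat_of_zero_le hq0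
  have := closedq q' _ (hm1 (b : ZMod (k+1))).1
  rw [show m (b : ZMod (k+1)) - q' * (k+1) = b by linarith] at this
  exact this

lemma Rep.young {k S r m} (h : Rep k S r m) : IsYoung S := by
  constructor
  · obtain ⟨N, hN⟩ := h.fin
    apply Set.Finite.subset (Set.finite_Iic (N, r 0))
    rintro ⟨i, j⟩ hij
    have h1 := (h.mem i j).1 hij
    have h2 := h.le_anti (Nat.zero_le i)
    have h3 : i < N := by
      by_contra h3
      rw [hN i (by omega)] at h1
      omega
    exact ⟨h3.le, by simp; omega⟩
  · rintro ⟨i, j⟩ hij ⟨i', j'⟩ h1 h2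
    simp only at h1 h2
    rw [h.mem] at hij ⊢
    have := h.le_anti h1
    omega

lemma Rep.core {k S r m} (h : Rep k S r m) : IsCore k S := by
  refine ⟨h.young, ?_⟩
  rintro ⟨i, j⟩ hij heq
  obtain ⟨c, hc⟩ := h.col
  have h1 := hook_eq h.mem hc i j hij
  have h2 := (h.bead _).1 ⟨i, rfl⟩
  have h3 : ((((r i : ℤ) - i - (k+1) : ℤ)) : ZMod (k+1)) = (((r i : ℤ) - i : ℤ) : ZMod (k+1)) := by
    have : ((k:ZMod (k+1)) + 1) = 0 := by exact_mod_cast ZMod.natCast_self (k+1)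
    push_cast
    rw [this]; ring
  obtain ⟨i', hi'⟩ := (h.bead ((r i : ℤ) - i - (k+1))).2 (by rw [h3]; omega)
  have := (bead_ne_gap hc i' j).2
  omega

lemma Rep.pmem {k S r m} (h : Rep k S r m) (i j : ℕ) :
    (i, j) ∈ pMap k S ↔ j < rk k m ((r i : ℤ) - i - (k+1)) := by
  obtain ⟨c, hc⟩ := h.col
  unfold pMap rk
  simp only [Set.mem_setOf_eq]
  suffices hs : {j | (i, j) ∈ S ∧ hookLen S (i, j) ≤ k}.ncard =
      {d | m d < (r i : ℤ) - i - (k+1)}.ncard by rw [hs]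
  have cont : ∀ j, (i, j) ∈ S ∧ hookLen S (i, j) ≤ k ↔
      (j : ℤ) - c j + 1 < (r i : ℤ) - i ∧ (r i : ℤ) - i ≤ (j : ℤ) - c j + 1 + k := by
    intro j
    constructor
    · rintro ⟨h1, h2⟩
      have h3 := hook_eq h.mem hc i j h1
      have h4 := (bead_ne_gap hc i j).1.1 ((h.mem i j).1 h1)
      omega
    · rintro ⟨h1, h2⟩
      have h4 := (h.mem i j).2 ((bead_ne_gap hc i j).1.2 h1)
      have h3 := hook_eq h.mem hc i j h4
      exact ⟨h4, by omega⟩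
  have cmono : ∀ a b, a < b → c b ≤ c a := by
    intro a b hab
    by_contra hlt
    push Not at hlt
    have h1 := (hc _ _).1 hlt
    have h2 := (hc (c a) a).2 (by omega)
    omega
  apply Set.ncard_congr (fun (j : ℕ) _ => (((j : ℤ) - (c j : ℤ) + 1 : ℤ) : ZMod (k+1)))
  · intro j hj
    have h1 := (cont j).1 hj
    set g := (j : ℤ) - c j + 1 with hg
    have h2 : ¬ g ≤ m (g : ZMod (k+1)) := fun hle => by
      obtain ⟨i', hi'⟩ := (h.bead g).2 hle
      exact (bead_ne_gap hc i' j).2 hi'.symm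
    have := zwin k (m (g : ZMod (k+1))) g (h.cls _) (by omega)
    show m (g : ZMod (k+1)) < _
    omega
  · intro a b ha hb hab
    have h1 := (cont a).1 ha
    have h2 := (cont b).1 hb
    rcases lt_trichotomy a b with h3 | h3 | h3
    · have h4 := cmono _ _ h3
      have := zwin k _ _ hab (by omega)
      omega
    · exact h3
    · have h4 := cmono _ _ h3
      have := zwin k _ _ hab.symm (by omega)
      omega
  · intro d hd
    simp only [Set.mem_setOf_eq] at hd
    obtain ⟨g, hg1, hg2, hg3⟩ := zrep k ((r i : ℤ) - i - (k+1)) d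
    rcases bead_or_gap h.anti hc h.fin g with hb | ⟨j, hj⟩
    · have := (h.bead g).1 hb
      rw [hg3] at this
      omega
    · refine ⟨j, ?_, by rw [hj]; exact hg3⟩
      apply (cont j).2
      have : g ≠ (r i : ℤ) - i - (k+1) := by
        intro heq
        have h2 := (h.bead _).1 ⟨i, rfl⟩
        have h3 : (((r i : ℤ) - i : ℤ) : ZMod (k+1)) = d := by
          have : ((k:ZMod (k+1)) + 1) = 0 := by exact_mod_cast ZMod.natCast_self (k+1)
          rw [← hg3, heq]
          push_cast
          rw [this]; ring
        rw [h3] at h2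
        omega
      omega

def mg (k : ℕ) (m : ZMod (k+1) → ℤ) (c d : ZMod (k+1)) : ℤ :=
  if d = c then m c + 1 else if d = c + 1 then m (c+1) - 1 else m d

def mstep (k : ℕ) (m : ZMod (k+1) → ℤ) (c d : ZMod (k+1)) : ℤ :=
  mg k m c (Equiv.swap c (c+1) d)

def rho (k : ℕ) (m : ZMod (k+1) → ℤ) (d : ZMod (k+1)) : ℕ := rk k m (m d)

lemma rk_mstep (k : ℕ) (m : ZMod (k+1) → ℤ) (c : ZMod (k+1)) (x : ℤ) :
    rk k (mstep k m c) x = {d | mg k m c d < x}.ncard := by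
  unfold rk mstep
  rw [← Set.ncard_image_of_injective {d | mg k m c ((Equiv.swap c (c+1)) d) < x}
    (Equiv.swap c (c+1)).injective]
  congr 1
  ext d
  constructor
  · rintro ⟨e, he, rfl⟩
    exact he
  · intro hd
    exact ⟨Equiv.swap c (c+1) d, by simpa using hd, by simp⟩

lemma m_inj {k : ℕ} {m : ZMod (k+1) → ℤ} (hm : ∀ d, ((m d : ℤ) : ZMod (k+1)) = d)
    {d e : ZMod (k+1)} (h : m d = m e) : d = e := by
  rw [← hm d, ← hm e, h]

lemma rho_inj {k : ℕ} {m : ZMod (k+1) → ℤ} (hm : ∀ d, ((m d : ℤ) : ZMod (k+1)) = d)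
    {d e : ZMod (k+1)} (h : rho k m d = rho k m e) : d = e := by
  apply m_inj hm
  rcases lt_trichotomy (m d) (m e) with h1 | h1 | h1
  · have := rk_lt k m d h1
    unfold rho at h
    omega
  · exact h1
  · have := rk_lt k m e h1
    unfold rho at h
    omega

lemma rho_mstep (k : ℕ) (m : ZMod (k+1) → ℤ) (c : ZMod (k+1))
    (hm : ∀ d, ((m d : ℤ) : ZMod (k+1)) = d) (hlt : m (c+1) < m c) (d : ZMod (k+1)) :
    rho k (mstep k m c) d = rho k m (Equiv.swap c (c+1) d) := by
  unfold rho
  rw [rk_mstep]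
  unfold rk mstep
  set d' := Equiv.swap c (c+1) d
  congr 1
  ext e
  simp only [Set.mem_setOf_eq]
  have A : ∀ f, m f = m c + 1 → f = c + 1 := by
    intro f hf
    rw [← hm f, hf]; push_cast; rw [hm]
  have B : ∀ f, m f = m (c+1) - 1 → f = c := by
    intro f hf
    rw [← hm f, hf]; push_cast; rw [hm]; ring
  have C : ∀ f, m f = m c → f = c := fun f hf => m_inj hm hf
  have D : ∀ f, m f = m (c+1) → f = c+1 := fun f hf => m_inj hm hf
  have hA := A e
  have hA' := A d'
  have hB := B e
  have hB' := B d'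
  have hC := C e
  have hC' := C d'
  have hD := D e
  have hD' := D d'
  clear_value d'
  have hM : e ≠ d' → m e ≠ m d' := fun h1 h2 => h1 (m_inj hm h2)
  unfold mg
  clear A B C D
  split_ifs <;> grind

lemma addable_iff {k S r m} (h : Rep k S r m) (i j : ℕ) :
    Addable S (i, j) ↔ j = r i ∧ ∀ i' : ℕ, (r i' : ℤ) - i' ≠ (r i : ℤ) - i + 1 := by
  constructor
  · rintro ⟨hn, -, hl⟩
    rw [h.mem] at hn
    have hj : j = r i := by
      by_contra hne
      have := hl (i, j) (by simp) (i, r i) le_rfl (by simp; omega)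
      rcases this with h1 | h1
      · rw [h.mem] at h1; omega
      · simp at h1; omega
    refine ⟨hj, ?_⟩
    intro i' hi'
    rcases lt_or_ge i' i with hlt | hge
    · have := hl (i, j) (by simp) (i', j) (by simp; omega) le_rfl
      rcases this with h1 | h1
      · rw [h.mem] at h1; omega
      · simp at h1; omega
    · have := h.le_anti hge
      omega
  · rintro ⟨rfl, hb⟩
    refine ⟨by rw [h.mem]; omega, (h.young.1).union (Set.finite_singleton _), ?_⟩
    rintro p (hp | hp) ⟨a, b⟩ ha hb'
    · exact Or.inl (h.young.2 p hp _ ha hb')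
    · rw [Set.mem_singleton_iff] at hp
      subst hp
      simp only at ha hb'
      rcases Nat.lt_or_ge a i with hlt | hge
      · left
        rw [h.mem]
        have h1 := h.le_anti (show a ≤ i - 1 by omega)
        have h2 := h.le_anti (show i - 1 ≤ i by omega)
        have h3 := hb (i-1)
        omega
      · have : a = i := by omega
        subst this
        rcases Nat.lt_or_ge b (r a) with h1 | h1
        · left; rw [h.mem]; exact h1
        · right
          simp; omega

lemma res_row (k i a : ℕ) : res k (i, a) = (((a : ℤ) - i : ℤ) : ZMod (k+1)) := by
  unfold res
  push_cast
  rfl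

lemma addable_res {k S r m} (hk : 1 ≤ k) (h : Rep k S r m) (c : ZMod (k+1)) (i j : ℕ) :
    Addable S (i, j) ∧ res k (i, j) = c ↔
      j = r i ∧ (((r i : ℤ) - i : ℤ) : ZMod (k+1)) = c ∧ m (c+1) < (r i : ℤ) - i := by
  rw [addable_iff h, res_row]
  constructor
  · rintro ⟨⟨rfl, hb⟩, hc⟩
    refine ⟨rfl, hc, ?_⟩
    have h1 := (h.bead ((r i : ℤ) - i + 1)).not.1 (fun ⟨i', hi'⟩ => hb i' hi')
    have h2 : (((r i : ℤ) - i + 1 : ℤ) : ZMod (k+1)) = c + 1 := by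
      rw [← hc]; push_cast; rfl
    rw [h2] at h1
    have h3 : m (c+1) ≠ (r i : ℤ) - i := by
      intro h4
      rw [← h4, h.cls] at hc
      exact one_ne k hk c hc
    omega
  · rintro ⟨rfl, hc, hlt⟩
    refine ⟨⟨rfl, ?_⟩, hc⟩
    intro i' hi'
    have h1 := (h.bead ((r i : ℤ) - i + 1)).1 ⟨i', hi'⟩
    have h2 : (((r i : ℤ) - i + 1 : ℤ) : ZMod (k+1)) = c + 1 := by
      rw [← hc]; push_cast; rfl
    rw [h2] at h1
    omega

lemma exists_addable {k S r m} (hk : 1 ≤ k) (h : Rep k S r m) (c : ZMod (k+1)) :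
    (∃ x, Addable S x ∧ res k x = c) ↔ m (c+1) < m c := by
  constructor
  · rintro ⟨⟨i, j⟩, hx⟩
    obtain ⟨-, hc, hlt⟩ := (addable_res hk h c i j).1 hx
    have := (h.bead _).1 ⟨i, rfl⟩
    rw [hc] at this
    omega
  · intro hlt
    obtain ⟨i, hi⟩ := (h.bead (m c)).2 (by rw [h.cls])
    refine ⟨(i, r i), (addable_res hk h c i _).2 ⟨rfl, ?_, ?_⟩⟩
    · rw [hi, h.cls]
    · rw [hi]; exact hlt

def rstep (k : ℕ) (r : ℕ → ℕ) (m : ZMod (k+1) → ℤ) (c : ZMod (k+1)) (i : ℕ) : ℕ :=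
  if (((r i : ℤ) - i : ℤ) : ZMod (k+1)) = c ∧ m (c+1) < (r i : ℤ) - i then r i + 1 else r i

lemma mstep_c (k : ℕ) (m : ZMod (k+1) → ℤ) (c) (hk : 1 ≤ k) : mstep k m c c = m (c+1) - 1 := by
  have := one_ne k hk c
  simp [mstep, mg, this]

lemma mstep_c1 (k : ℕ) (m : ZMod (k+1) → ℤ) (c) : mstep k m c (c+1) = m c + 1 := by
  simp [mstep, mg]

lemma mstep_o (k : ℕ) (m : ZMod (k+1) → ℤ) (c d) (h1 : d ≠ c) (h2 : d ≠ c + 1) :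
    mstep k m c d = m d := by
  simp [mstep, mg, Equiv.swap_apply_of_ne_of_ne h1 h2, h1, h2]

lemma step_rep {k S r m} (hk : 1 ≤ k) (h : Rep k S r m) (c : ZMod (k+1)) (hlt : m (c+1) < m c) :
    Rep k (S ∪ {x | Addable S x ∧ res k x = c}) (rstep k r m c) (mstep k m c) := by
  have h1ne := one_ne k hk c
  refine ⟨?_, ?_, ?_, ?_, ?_⟩
  · intro i j
    have := addable_res hk h c i j
    simp only [Set.mem_union, Set.mem_setOf_eq, h.mem, this]
    unfold rstep
    split_ifs with hc
    · simp only [hc, and_self, and_true]; omega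
    · simp only [hc, and_false, or_false]
  · intro i
    unfold rstep
    have h0 := h.anti i
    by_cases h2 : ((((r (i+1) : ℕ) : ℤ) - ((i+1 : ℕ) : ℤ) : ℤ) : ZMod (k+1)) = c ∧
      m (c+1) < ((r (i+1) : ℕ) : ℤ) - ((i+1 : ℕ) : ℤ)
    · rw [if_pos h2]
      have : r (i+1) < r i := by
        by_contra hge
        have heq : r i = r (i+1) := by omega
        have h3 := (h.bead _).1 ⟨i, rfl⟩
        have h4 : (((r i : ℤ) - i : ℤ) : ZMod (k+1)) = c + 1 := by
          rw [← h2.1, heq]; push_cast; ring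
        rw [h4] at h3
        have := h2.2
        omega
      split_ifs <;> omega
    · rw [if_neg h2]
      split_ifs <;> omega
  · obtain ⟨N, hN⟩ := h.fin
    refine ⟨N + 1 + (- m (c+1)).toNat, fun i hi => ?_⟩
    unfold rstep
    rw [hN i (by omega), if_neg]
    rintro ⟨-, h2⟩
    omega
  · intro d
    by_cases hd : d = c
    · subst hd
      rw [mstep_c k m d hk]; push_cast; rw [h.cls]; ring
    · by_cases hd' : d = c + 1
      · subst hd'
        rw [mstep_c1]; push_cast; rw [h.cls]
      · rw [mstep_o _ _ _ _ hd hd', h.cls]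
  · intro b
    constructor
    · rintro ⟨i, hi⟩
      unfold rstep at hi
      have hb := (h.bead _).1 ⟨i, rfl⟩
      split_ifs at hi with hc
      · have : (b : ZMod (k+1)) = c + 1 := by
          rw [← hi, ← hc.1]; push_cast; ring
        rw [this, mstep_c1]
        rw [hc.1] at hb
        push_cast at hi
        omega
      · rw [hi] at hb hc
        by_cases hd : (b : ZMod (k+1)) = c
        · rw [hd, mstep_c _ _ _ hk]
          have : ¬ m (c+1) < b := fun h' => hc ⟨hd, h'⟩
          have : m (c+1) ≠ b := by
            intro h4
            rw [← h4, h.cls] at hd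
            exact h1ne hd
          omega
        · by_cases hd' : (b : ZMod (k+1)) = c + 1
          · rw [hd', mstep_c1]
            rw [hd'] at hb
            omega
          · rw [mstep_o _ _ _ _ hd hd']
            exact hb
    · intro hb
      unfold rstep
      by_cases hd : (b : ZMod (k+1)) = c
      · rw [hd, mstep_c _ _ _ hk] at hb
        obtain ⟨i, hi⟩ := (h.bead b).2 (by rw [hd]; omega)
        refine ⟨i, ?_⟩
        rw [if_neg]
        · exact hi
        · rintro ⟨-, h2⟩
          omega
      · by_cases hd' : (b : ZMod (k+1)) = c + 1
        · rw [hd', mstep_c1] at hb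
          by_cases hle : b ≤ m (c+1)
          · obtain ⟨i, hi⟩ := (h.bead b).2 (by rw [hd']; omega)
            refine ⟨i, ?_⟩
            rw [if_neg]
            · exact hi
            · rintro ⟨h2, -⟩
              rw [hi] at h2
              exact hd h2
          · have hc : ((b - 1 : ℤ) : ZMod (k+1)) = c := by
              push_cast; rw [hd']; ring
            obtain ⟨i, hi⟩ := (h.bead (b-1)).2 (by rw [hc]; omega)
            refine ⟨i, ?_⟩
            have : m (c+1) ≠ b - 1 := by
              intro h4
              rw [← h4, h.cls] at hc
              exact h1ne hc
            rw [if_pos]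
            · push_cast; omega
            · rw [hi]
              exact ⟨hc, by omega⟩
        · rw [mstep_o _ _ _ _ hd hd'] at hb
          obtain ⟨i, hi⟩ := (h.bead b).2 hb
          refine ⟨i, ?_⟩
          rw [if_neg]
          · exact hi
          · rintro ⟨h2, -⟩
            rw [hi] at h2
            exact hd h2

lemma row_step {k S r m} (hk : 1 ≤ k) (h : Rep k S r m) (c : ZMod (k+1)) (hlt : m (c+1) < m c)
    (i : ℕ) :
    rk k (mstep k m c) ((rstep k r m c i : ℤ) - i - (k+1)) =
      if (r i : ℤ) - i = m (c+1) + k then rk k m ((r i : ℤ) - i - (k+1)) + 1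
      else rk k m ((r i : ℤ) - i - (k+1)) := by
  have h1ne := one_ne k hk c
  have hn : ((k:ZMod (k+1)) + 1) = 0 := by exact_mod_cast ZMod.natCast_self (k+1)
  have hbead := (h.bead _).1 ⟨i, rfl⟩
  rw [rk_mstep]
  unfold rstep
  set β : ℤ := (r i : ℤ) - i with hβ
  by_cases hc : (β : ZMod (k+1)) = c ∧ m (c+1) < β
  · rw [if_pos hc]
    rw [hc.1] at hbead
    have e1 : (((r i + 1 : ℕ) : ℤ) - i - (k+1)) = β + 1 - (k+1) := by push_cast; omega
    rw [e1]
    have hge := zwin k (m (c+1) - 1) β (by push_cast; rw [h.cls, hc.1]; ring) (by omega)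
    have other : ∀ d, d ≠ c → m d ≠ β - (k+1) := by
      intro d hd hm
      apply hd
      rw [← h.cls d, hm, ← hc.1]
      push_cast
      rw [hn]; ring
    split_ifs with hb
    · unfold rk
      rw [← Set.ncard_insert_of_notMem (a := c+1) (by simp; omega) (Set.toFinite _)]
      congr 1
      ext d
      simp only [Set.mem_setOf_eq, Set.mem_insert_iff]
      have := other d
      unfold mg
      split_ifs with h1 h2
      · subst h1
        constructor
        · intro; omega
        · rintro (h3 | h3)
          · exact absurd h3.symm h1ne
          · omega
      · simp only [h2, true_or, iff_true]; omega
      · have := this h1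
        simp only [h2, false_or]
        omega
    · unfold rk
      congr 1
      ext d
      simp only [Set.mem_setOf_eq]
      have := other d
      unfold mg
      have hge2 : m (c+1) - 1 + (k+1) + (k+1) ≤ β := by
        apply zwin k (m (c+1) - 1 + (k+1)) β
        · push_cast; rw [h.cls, hc.1, hn]; ring
        · omega
      split_ifs with h1 h2
      · subst h1; omega
      · subst h2; omega
      · have := this h1; omega
  · rw [if_neg hc]
    have hb : β ≠ m (c+1) + k := by
      intro hb
      apply hc
      constructor
      · rw [hb]; push_cast; rw [h.cls, add_assoc, add_comm 1, hn, add_zero]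
      · omega
    rw [if_neg hb, ← hβ]
    unfold rk
    congr 1
    ext d
    simp only [Set.mem_setOf_eq]
    unfold mg
    split_ifs with h1 h2
    · subst h1
      have : m d ≠ β - (k+1) - 1 := by
        intro h3
        have h4 : (β : ZMod (k+1)) = d + 1 := by
          rw [← h.cls d, h3]; push_cast; rw [hn]; ring
        rw [h4] at hbead
        omega
      omega
    · subst h2
      have : m (c+1) ≠ β - (k+1) := by
        intro h3
        have h4 : (β : ZMod (k+1)) = c + 1 := by
          rw [← h.cls (c+1), h3]; push_cast; rw [hn]; ring
        rw [h4] at hbead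
        omega
      omega
    · rfl

lemma step_full {k S r m} (hk : 1 ≤ k) (h : Rep k S r m) (c : ZMod (k+1)) (hlt : m (c+1) < m c) :
    ∃ x : Cell, x ∉ pMap k S ∧ x.2 = rho k m (c+1) ∧
      pMap k (S ∪ {x | Addable S x ∧ res k x = c}) = insert x (pMap k S) := by
  have hn : ((k:ZMod (k+1)) + 1) = 0 := by exact_mod_cast ZMod.natCast_self (k+1)
  have h' := step_rep hk h c hlt
  have hge := zwin k (m (c+1) - 1) (m c) (by push_cast; rw [h.cls, h.cls]; ring) (by omega)
  have hcl : ((m (c+1) + k : ℤ) : ZMod (k+1)) = c := by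
    push_cast; rw [h.cls, add_assoc, add_comm 1, hn, add_zero]
  obtain ⟨i, hi⟩ := (h.bead (m (c+1) + k)).2 (by rw [hcl]; omega)
  have hrk : rk k m ((r i : ℤ) - i - (k+1)) = rho k m (c+1) := by
    unfold rho rk
    congr 1
    ext d
    simp only [Set.mem_setOf_eq]
    have : m d ≠ m (c+1) - 1 := by
      intro h3
      have : d = c := by rw [← h.cls d, h3]; push_cast; rw [h.cls]; ring
      subst this
      omega
    omega
  refine ⟨(i, rho k m (c+1)), ?_, rfl, ?_⟩
  · rw [h.pmem, hrk]; omega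
  · ext ⟨a, b⟩
    rw [h'.pmem, row_step hk h c hlt, Set.mem_insert_iff, h.pmem, Prod.mk.injEq]
    split_ifs with hb
    · have : a = i := by
        rcases lt_trichotomy a i with h1 | h1 | h1
        · have := h.le_anti h1.le; omega
        · exact h1
        · have := h.le_anti h1.le; omega
      subst this
      rw [hrk]
      omega
    · have : a ≠ i := by rintro rfl; exact hb hi
      simp [this]

lemma pMap_lower {k S r m} (h : Rep k S r m) {i i' j : ℕ} (hi : i ≤ i')
    (hm : (i', j) ∈ pMap k S) : (i, j) ∈ pMap k S := by
  rw [h.pmem] at hm ⊢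
  refine lt_of_lt_of_le hm (rk_mono k m ?_)
  have := h.le_anti hi
  omega

lemma rho_surj {k : ℕ} {m : ZMod (k+1) → ℤ} (hm : ∀ d, ((m d : ℤ) : ZMod (k+1)) = d)
    (j : ℕ) (hj : j ≤ k) : ∃ d, rho k m d = j := by
  have hlt : ∀ d, rho k m d < k + 1 := by
    intro d
    have h1 : rho k m d < (Set.univ : Set (ZMod (k+1))).ncard := by
      apply Set.ncard_lt_ncard _ (Set.toFinite _)
      rw [Set.ssubset_univ_iff]
      intro heq
      have : d ∈ {e | m e < m d} := by rw [heq]; trivial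
      simp at this
    rw [Set.ncard_univ, Nat.card_zmod] at h1
    exact h1
  let f : ZMod (k+1) → Fin (k+1) := fun d => ⟨rho k m d, hlt d⟩
  have hf : Function.Injective f := by
    intro a b hab
    exact rho_inj hm (by simpa [f] using hab)
  have hb : Function.Bijective f :=
    (Fintype.bijective_iff_injective_and_card f).2 ⟨hf, by simp [ZMod.card]⟩
  obtain ⟨d, hd⟩ := hb.2 ⟨j, by omega⟩
  exact ⟨d, by simpa [f] using congrArg Fin.val hd⟩

lemma pMap_surj (k : ℕ) (hk : 1 ≤ k) : ∀ (N : ℕ) (lam : Set Cell), IsBounded k lam →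
    lam.ncard = N → ∃ S, IsCore k S ∧ pMap k S = lam := by
  intro N
  induction N with
  | zero =>
    intro lam hl hN
    have h0 : lam = ∅ := (Set.ncard_eq_zero hl.1.1).1 hN
    refine ⟨∅, ⟨⟨Set.finite_empty, by simp⟩, by simp⟩, ?_⟩
    rw [h0]
    ext x
    simp [pMap]
  | succ N ih =>
    intro lam hl hN
    obtain ⟨l, hmem, hanti, hfin⟩ := young_rows hl.1
    have lanti : ∀ {a b}, a ≤ b → l b ≤ l a := fun hab => antitone_nat_of_succ_le hanti hab
    obtain ⟨L, hL, hL'⟩ : ∃ L, 0 < l L ∧ ∀ i, L < i → l i = 0 := by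
      have hne : lam.Nonempty := by
        apply Set.nonempty_of_ncard_ne_zero; omega
      obtain ⟨⟨a, b⟩, hab⟩ := hne
      rw [hmem] at hab
      obtain ⟨M, hM⟩ := hfin
      have ex : ∃ i, l i = 0 := ⟨M, hM M le_rfl⟩
      have hpos : Nat.find ex ≠ 0 := by
        intro h0
        have := Nat.find_spec ex
        rw [h0] at this
        have := lanti (Nat.zero_le a)
        omega
      refine ⟨Nat.find ex - 1, ?_, ?_⟩
      · have := Nat.find_min ex (show Nat.find ex - 1 < Nat.find ex by omega)
        omega
      · intro i hi
        have h1 := Nat.find_spec ex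
        have := lanti (show Nat.find ex ≤ i by omega)
        omega
    obtain ⟨j, hj⟩ : ∃ j, l L = j + 1 := ⟨l L - 1, by omega⟩
    have hx : (L, j) ∈ lam := by rw [hmem]; omega
    have hjk : j < k := hl.2 _ hx
    have hcard : (lam \ {(L, j)}).ncard = N := by
      rw [Set.ncard_diff_singleton_of_mem hx]; omega
    have hmem' : ∀ a b, (a, b) ∈ lam \ {(L, j)} ↔ b < l a ∧ ¬ (a = L ∧ b = j) := by
      intro a b
      simp [hmem]
    have hbd : IsBounded k (lam \ {(L, j)}) := by
      refine ⟨⟨hl.1.1.subset Set.diff_subset, ?_⟩, fun c hc => hl.2 c hc.1⟩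
      rintro ⟨a, b⟩ hab ⟨a', b'⟩ h1 h2
      simp only at h1 h2
      rw [hmem'] at hab ⊢
      have := lanti h1
      refine ⟨by omega, ?_⟩
      rintro ⟨rfl, rfl⟩
      rcases Nat.lt_or_ge a' a with h3 | h3
      · have := hL' a h3
        omega
      · have : a = a' := by omega
        subst this
        omega
    obtain ⟨S, hS, hP⟩ := ih _ hbd hcard
    obtain ⟨r, m, h⟩ := core_rep k hS
    have hrow : ∀ i, i ≠ L → rk k m ((r i : ℤ) - i - (k+1)) = l i := by
      intro i hi
      have key : ∀ b, b < rk k m ((r i : ℤ) - i - (k+1)) ↔ b < l i := by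
        intro b
        rw [← h.pmem, hP, hmem']
        simp [hi]
      have h1 := key (l i)
      have h2 := key (rk k m ((r i : ℤ) - i - (k+1)))
      omega
    have hrowL : rk k m ((r L : ℤ) - L - (k+1)) = j := by
      have key : ∀ b, b < rk k m ((r L : ℤ) - L - (k+1)) ↔ b < j := by
        intro b
        rw [← h.pmem, hP, hmem']
        simp only [true_and]
        omega
      have h1 := key j
      have h2 := key (rk k m ((r L : ℤ) - L - (k+1)))
      omega
    obtain ⟨d, hd⟩ := rho_surj h.cls j (by omega)
    obtain ⟨D, hD⟩ := rho_surj h.cls k le_rfl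
    have hdD : m d < m D := by
      by_contra hge
      have := rk_mono k m (not_lt.1 hge)
      unfold rho at hd hD
      omega
    have uniq : ∀ i, 1 ≤ rk k m ((r i : ℤ) - i - (k+1)) → rk k m ((r i : ℤ) - i - (k+1)) ≤ j →
        i = L := by
      intro i h1 h2
      by_contra hne
      rw [hrow i hne] at h1 h2
      rcases lt_or_gt_of_ne hne with h3 | h3
      · have := lanti h3.le
        omega
      · have := hL' i h3
        omega
    obtain ⟨c, rfl⟩ : ∃ c, d = c + 1 := ⟨d - 1, by ring⟩
    have hrd : rk k m (m (c+1)) = j := hd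
    have hn : ((k:ZMod (k+1)) + 1) = 0 := by exact_mod_cast ZMod.natCast_self (k+1)
    have hlt : m (c+1) < m c := by
      by_contra hge
      have hne : m c ≠ m (c+1) := fun h1 => one_ne k hk c (m_inj h.cls h1).symm
      have hlt : m c < m (c+1) := by omega
      have hr1 := rk_lt k m c hlt
      rcases eq_or_lt_of_le (show m c + 1 ≤ m (c+1) by omega) with h1 | h1
      · have h2 : m c < (r L : ℤ) - L - (k+1) := by
          by_contra h3
          have := rk_mono k m (not_lt.1 h3)
          omega
        have h3 : ¬ m (c+1) < (r L : ℤ) - L - (k+1) := by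
          intro h3
          have := rk_lt k m _ h3
          omega
        have h4 : (r L : ℤ) - L = m (c+1) + (k+1) := by omega
        have h5 := (h.bead _).1 ⟨L, rfl⟩
        rw [h4] at h5
        have h6 : ((m (c+1) + (k+1) : ℤ) : ZMod (k+1)) = c + 1 := by
          push_cast; rw [h.cls, hn, add_zero]
        rw [h6] at h5
        omega
      · have h2 := zwin k (m c + 1) (m (c+1)) (by push_cast; rw [h.cls, h.cls]) h1
        have h6 : ((m c + 1 + (k+1) : ℤ) : ZMod (k+1)) = c + 1 := by
          push_cast; rw [h.cls, hn, add_zero]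
        obtain ⟨i1, hi1⟩ := (h.bead (m c + 1 + (k+1))).2 (by rw [h6]; exact h2)
        have e1 : i1 = L := by
          apply uniq
          · have := rk_lt k m (y := (r i1 : ℤ) - i1 - (k+1)) c (by omega)
            omega
          · have := rk_mono k m (show (r i1 : ℤ) - i1 - (k+1) ≤ m (c+1) by omega)
            omega
        obtain ⟨g, hg1, hg2, hg3⟩ := zrep k (m (c+1) + 1) D
        have h7 : g ≤ m D := by
          by_contra h8
          have := zwin k (m D) g (by rw [h.cls, hg3]) (by omega)
          omega
        obtain ⟨i2, hi2⟩ := (h.bead g).2 (by rw [hg3]; exact h7)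
        have e2 : i2 = L := by
          apply uniq
          · have := rk_lt k m (y := (r i2 : ℤ) - i2 - (k+1)) c (by omega)
            omega
          · have := rk_mono k m (show (r i2 : ℤ) - i2 - (k+1) ≤ m (c+1) by omega)
            omega
        subst e1
        subst e2
        omega
    obtain ⟨⟨i, jj⟩, hx1, hx2, hx3⟩ := step_full hk h c hlt
    have h' := step_rep hk h c hlt
    simp only at hx2
    rw [hd] at hx2
    subst hx2
    refine ⟨_, h'.core, ?_⟩
    have hiL : i = L := by
      rcases lt_trichotomy i L with h1 | h1 | h1
      · exfalso
        apply hx1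
        rw [hP, hmem']
        have := lanti h1.le
        exact ⟨by omega, by omega⟩
      · exact h1
      · exfalso
        have h2 := pMap_lower h' h1.le (j := jj) (by rw [hx3]; exact Set.mem_insert _ _)
        rw [hx3, hP] at h2
        rcases h2 with h2 | h2
        · simp at h2; omega
        · exact h2.2 rfl
    subst hiL
    rw [hx3, hP]
    ext y
    simp only [Set.mem_insert_iff, Set.mem_diff, Set.mem_singleton_iff]
    constructor
    · rintro (h1 | h1)
      · rw [h1]; exact hx
      · exact h1.1
    · intro h1
      by_cases h2 : y = (i, jj)
      · exact Or.inl h2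
      · exact Or.inr ⟨h1, h2⟩

lemma pInv_spec (k : ℕ) (hk : 1 ≤ k) (lam : Set Cell) (hl : IsBounded k lam) :
    IsCore k (pInv k lam) ∧ pMap k (pInv k lam) = lam := by
  obtain ⟨S, hS, hP⟩ := pMap_surj k hk _ lam hl rfl
  have ex : ∃ a ∈ {S | IsCore k S}, pMap k a = lam := ⟨S, hS, hP⟩
  exact ⟨Function.invFunOn_mem ex, Function.invFunOn_eq ex⟩

/-! ### Runs -/

lemma star_step {k S r m} (hk : 1 ≤ k) (h : Rep k S r m) (c : ZMod (k+1)) (S' : Set Cell)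
    (hs : starC k c (some S) = some S') :
    ∃ r' m', Rep k S' r' m' ∧ ((pMap k S' = pMap k S ∧ m' = m) ∨
      ∃ x, x ∉ pMap k S ∧ x.2 = rho k m (c+1) ∧ pMap k S' = insert x (pMap k S) ∧
        ∀ d, rho k m' d = rho k m (Equiv.swap c (c+1) d)) := by
  simp only [starC] at hs
  split_ifs at hs with h1 h2
  · have hlt := (exists_addable hk h c).1 h1
    obtain rfl := Option.some.inj hs
    obtain ⟨x, hx1, hx2, hx3⟩ := step_full hk h c hlt
    exact ⟨_, _, step_rep hk h c hlt, Or.inr ⟨x, hx1, hx2, hx3, rho_mstep k m c h.cls hlt⟩⟩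
  · obtain rfl := Option.some.inj hs
    exact ⟨r, m, h, Or.inl ⟨rfl, rfl⟩⟩

def touched (k : ℕ) (W : Word k) (d : ZMod (k+1)) : Prop := d ∈ W ∨ ∃ c ∈ W, d = c + 1

lemma touched_cons {k : ℕ} {W : Word k} {a d : ZMod (k+1)} :
    touched k (a :: W) d ↔ d = a ∨ d = a + 1 ∨ touched k W d := by
  unfold touched
  simp only [List.mem_cons, exists_eq_or_imp]
  tauto

structure Inv (k : ℕ) (W : Word k) (m0 : ZMod (k+1) → ℤ) (P0 : Set Cell)
    (m : ZMod (k+1) → ℤ) (P : Set Cell) : Prop where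
  sub : P0 ⊆ P
  fin : (P \ P0).Finite
  card : (P \ P0).ncard ≤ W.length
  unt : ∀ d, ¬ touched k W d → rho k m d = rho k m0 d
  tch : ∀ d, touched k W d → ∃ d', touched k W d' ∧ rho k m d = rho k m0 d'
  cols : ∀ x ∈ P \ P0, ∃ d, touched k W d ∧ x.2 = rho k m0 d

lemma Inv.any {k W m0 P0 m P} (h : Inv k W m0 P0 m P) (a d : ZMod (k+1))
    (hd : touched k (a :: W) d) : ∃ d', touched k (a :: W) d' ∧ rho k m d = rho k m0 d' := by
  by_cases ht : touched k W d
  · obtain ⟨d', h1, h2⟩ := h.tch d ht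
    exact ⟨d', touched_cons.2 (Or.inr (Or.inr h1)), h2⟩
  · exact ⟨d, hd, h.unt d ht⟩

lemma Inv.nil (k m0 P0) : Inv k [] m0 P0 m0 P0 := by
  refine ⟨subset_rfl, by simp, by simp, fun _ _ => rfl, ?_, by simp⟩
  intro d hd
  exact ⟨d, hd, rfl⟩

lemma Inv.step {k W m0 P0 m S r} (hk : 1 ≤ k) (hS : Rep k S r m)
    (hm0 : ∀ d, ((m0 d : ℤ) : ZMod (k+1)) = d)
    (h : Inv k W m0 P0 m (pMap k S)) (a : ZMod (k+1)) (S' : Set Cell)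
    (hs : starC k a (some S) = some S') :
    ∃ r' m', Rep k S' r' m' ∧ Inv k (a :: W) m0 P0 m' (pMap k S') ∧
      (pMap k S' \ P0 = pMap k S \ P0 ∨
        ∃ x, x ∉ pMap k S \ P0 ∧ pMap k S' \ P0 = insert x (pMap k S \ P0) ∧
          (¬ touched k W (a+1) → ∀ y ∈ pMap k S \ P0, y.2 ≠ x.2)) := by
  obtain ⟨r', m', hR, ⟨hP, rfl⟩ | ⟨x, hx1, hx2, hP, hrho⟩⟩ := star_step hk hS a S' hs
  · refine ⟨r', m', hR, ?_, Or.inl (by rw [hP])⟩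
    rw [hP]
    refine ⟨h.sub, h.fin, h.card.trans (by simp), ?_, fun d hd => h.any a d hd, ?_⟩
    · intro d hd
      exact h.unt d (fun h' => hd (touched_cons.2 (Or.inr (Or.inr h'))))
    · intro y hy
      obtain ⟨d, h1, h2⟩ := h.cols y hy
      exact ⟨d, touched_cons.2 (Or.inr (Or.inr h1)), h2⟩
  · have hD : pMap k S' \ P0 = insert x (pMap k S \ P0) := by
      rw [hP, Set.insert_diff_of_notMem]
      exact fun h' => hx1 (h.sub h')
    have hxD : x ∉ pMap k S \ P0 := fun h' => hx1 h'.1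
    refine ⟨r', m', hR, ⟨?_, ?_, ?_, ?_, ?_, ?_⟩, Or.inr ⟨x, hxD, hD, ?_⟩⟩
    · rw [hP]; exact h.sub.trans (Set.subset_insert _ _)
    · rw [hD]; exact h.fin.insert _
    · rw [hD, Set.ncard_insert_of_notMem hxD h.fin]
      have := h.card
      simp; omega
    · intro d hd
      rw [touched_cons] at hd
      push Not at hd
      rw [hrho, Equiv.swap_apply_of_ne_of_ne hd.1 hd.2.1]
      exact h.unt d hd.2.2
    · intro d hd
      rw [hrho]
      apply h.any
      rw [touched_cons] at hd ⊢
      by_cases h1 : d = a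
      · subst h1; simp
      · by_cases h2 : d = a + 1
        · subst h2; simp
        · rw [Equiv.swap_apply_of_ne_of_ne h1 h2]; exact hd
    · rw [hD]
      rintro y (rfl | hy)
      · rw [hx2]
        exact h.any a (a+1) (touched_cons.2 (Or.inr (Or.inl rfl)))
      · obtain ⟨d, h1, h2⟩ := h.cols y hy
        exact ⟨d, touched_cons.2 (Or.inr (Or.inr h1)), h2⟩
    · intro hnt y hy heq
      obtain ⟨d, h1, h2⟩ := h.cols y hy
      rw [hx2, h.unt _ hnt, h2] at heq
      have := rho_inj hm0 heq
      subst this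
      exact hnt h1

lemma starCW_cons {k : ℕ} {a : ZMod (k+1)} {W : Word k} {S0 S' : Set Cell}
    (h : starCW k (a :: W) (some S0) = some S') :
    ∃ S, starCW k W (some S0) = some S ∧ starC k a (some S) = some S' := by
  have h1 : starCW k (a :: W) (some S0) = starC k a (starCW k W (some S0)) := rfl
  rw [h1] at h
  cases h2 : starCW k W (some S0) with
  | none => rw [h2] at h; simp [starC] at h
  | some S => exact ⟨S, rfl, by rw [← h2]; exact h⟩

lemma pos_succ (k : ℕ) (T : Finset (Idx k)) (a : Idx k) (ha : a ≠ gap k T) :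
    pos k T (a + 1) = pos k T a + 1 := by
  unfold pos
  have h1 : a + 1 - gap k T - 1 = (a - gap k T - 1) + 1 := by ring
  rw [h1]
  set x := a - gap k T - 1 with hx
  have hlt : x.val + 1 < k + 1 := by
    have h2 := ZMod.val_lt x
    by_contra h3
    have h4 : x.val = k := by omega
    apply ha
    have h5 : (x : ZMod (k+1)) = (k : ZMod (k+1)) :=
      (ZMod.natCast_zmod_val x).symm.trans (congrArg (Nat.cast : ℕ → ZMod (k+1)) h4)
    have hn : ((k:ZMod (k+1)) + 1) = 0 := by exact_mod_cast ZMod.natCast_self (k+1)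
    have h6 : a - gap k T = 0 := by
      rw [← hn, ← h5, hx]; ring
    exact sub_eq_zero.1 h6
  have : x + 1 = ((x.val + 1 : ℕ) : ZMod (k+1)) := by
    push_cast; rw [ZMod.natCast_zmod_val]
  rw [this, ZMod.val_natCast_of_lt hlt]

lemma gap_notMem (k : ℕ) (T : Finset (Idx k)) (hT : T ≠ Finset.univ) : gap k T ∉ T := by
  have ex : ∃ n : ℕ, n ≤ k ∧ (n : Idx k) ∉ T := by
    by_contra hcon
    push Not at hcon
    apply hT
    ext x
    simp only [Finset.mem_univ, iff_true]
    have := hcon x.val (by have := ZMod.val_lt x; omega)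
    rwa [ZMod.natCast_zmod_val] at this
  unfold gap gapNat
  rw [dif_pos ex]
  exact (Nat.find_spec ex).2

lemma runH (k : ℕ) (hk : 1 ≤ k) (T : Finset (Idx k)) (hT : T ≠ Finset.univ) (S0 : Set Cell)
    (r0 m0) (h0 : Rep k S0 r0 m0) : ∀ (W : Word k) (_ : ∀ a ∈ W, a ∈ T)
    (_ : List.Pairwise (fun a b => pos k T b < pos k T a) W) (S : Set Cell),
    starCW k W (some S0) = some S → ∃ r m, Rep k S r m ∧ Inv k W m0 (pMap k S0) m (pMap k S) ∧
      Set.InjOn Prod.snd (pMap k S \ pMap k S0) := by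
  intro W
  induction W with
  | nil =>
    intro _ _ S hS
    obtain rfl := Option.some.inj hS
    exact ⟨r0, m0, h0, Inv.nil _ _ _, by simp⟩
  | cons a W ih =>
    intro hWT hW S' hS'
    obtain ⟨S, hS1, hS2⟩ := starCW_cons hS'
    rw [List.pairwise_cons] at hW
    obtain ⟨r, m, hR, hI, hinj⟩ := ih (fun b hb => hWT b (List.mem_cons_of_mem _ hb)) hW.2 S hS1
    obtain ⟨r', m', hR', hI', hD⟩ := hI.step hk hR h0.cls a S' hS2
    refine ⟨r', m', hR', hI', ?_⟩
    have hps : pos k T (a+1) = pos k T a + 1 := pos_succ k T a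
      (fun h => gap_notMem k T hT (h ▸ hWT a (List.mem_cons_self)))
    have hnt : ¬ touched k W (a+1) := by
      rintro (h1 | ⟨c, hc, h1⟩)
      · have := hW.1 _ h1
        omega
      · have h2 := hW.1 _ hc
        have : a = c := by simpa using h1
        subst this
        omega
    rcases hD with hD | ⟨x, hx, hD, hf⟩
    · rw [hD]; exact hinj
    · rw [hD, Set.injOn_insert hx]
      refine ⟨hinj, ?_⟩
      rintro ⟨y, hy, hyx⟩
      exact hf hnt y hy hyx

lemma numSeg_cons (k : ℕ) (T : Finset (Idx k)) (a e : Idx k) (W : Word k) :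
    numSegments k T (a :: e :: W) = numSegments k T (e :: W) +
      if pos k T e ≠ pos k T a + 1 then 1 else 0 := by
  unfold numSegments
  simp only [List.length_cons, List.tail_cons, List.zip_cons_cons, List.countP_cons]
  simp
  split_ifs <;> omega

lemma runV (k : ℕ) (hk : 1 ≤ k) (T : Finset (Idx k)) (hT : T ≠ Finset.univ) (S0 : Set Cell)
    (r0 m0) (h0 : Rep k S0 r0 m0) : ∀ (W : Word k) (_ : ∀ a ∈ W, a ∈ T)
    (_ : List.Pairwise (fun a b => pos k T a < pos k T b) W) (S : Set Cell),
    starCW k W (some S0) = some S → ∃ r m, Rep k S r m ∧ Inv k W m0 (pMap k S0) m (pMap k S) ∧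
      (pMap k S \ pMap k S0).ncard + numSegments k T W ≤
        (Prod.snd '' (pMap k S \ pMap k S0)).ncard + W.length := by
  intro W
  induction W with
  | nil =>
    intro _ _ S hS
    obtain rfl := Option.some.inj hS
    exact ⟨r0, m0, h0, Inv.nil _ _ _, by simp [numSegments]⟩
  | cons a W ih =>
    intro hWT hW S' hS'
    obtain ⟨S, hS1, hS2⟩ := starCW_cons hS'
    rw [List.pairwise_cons] at hW
    obtain ⟨r, m, hR, hI, hb⟩ := ih (fun b hb => hWT b (List.mem_cons_of_mem _ hb)) hW.2 S hS1
    obtain ⟨r', m', hR', hI', hD⟩ := hI.step hk hR h0.cls a S' hS2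
    refine ⟨r', m', hR', hI', ?_⟩
    have hps : pos k T (a+1) = pos k T a + 1 := pos_succ k T a
      (fun h => gap_notMem k T hT (h ▸ hWT a (List.mem_cons_self)))
    have hle : numSegments k T (a :: W) ≤ numSegments k T W + 1 := by
      cases W with
      | nil => simp [numSegments]
      | cons e W' => rw [numSeg_cons]; split_ifs <;> omega
    have hcase : numSegments k T (a :: W) ≤ numSegments k T W ∨ ¬ touched k W (a+1) := by
      cases W with
      | nil => right; simp [touched]
      | cons e W' =>
        rw [numSeg_cons]
        split_ifs with he
        · right
          have he1 := hW.1 e List.mem_cons_self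
          rintro (h1 | ⟨c, hc, h1⟩)
          · rcases List.mem_cons.1 h1 with h1 | h1
            · rw [← h1] at he; exact he hps
            · have := (List.pairwise_cons.1 hW.2).1 _ h1
              omega
          · have h2 := hW.1 _ hc
            have : a = c := by simpa using h1
            subst this
            omega
        · left; omega
    rcases hD with hD | ⟨x, hx, hD, hf⟩
    · rw [hD, List.length_cons]; omega
    · rw [hD, Set.ncard_insert_of_notMem hx hI.fin, Set.image_insert_eq, List.length_cons]
      have hfi : (Prod.snd '' (pMap k S \ pMap k S0)).Finite := hI.fin.image _
      rcases hcase with hcase | hcase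
      · have := Set.ncard_le_ncard (Set.subset_insert x.2 (Prod.snd '' (pMap k S \ pMap k S0)))
          (hfi.insert _)
        omega
      · rw [Set.ncard_insert_of_notMem _ hfi]
        · omega
        · rintro ⟨y, hy, hyx⟩
          exact hf hcase y hy hyx

/-! ### Heights -/

lemma ht_le (D : Set Cell) (hD : D.Finite) :
    htSkew D ≤ {i : ℕ | ∃ j, (i, j) ∈ D ∧ (i+1, j) ∈ D}.ncard := by
  unfold htSkew
  have hrow : {i : ℕ | ∃ j, (i, j) ∈ D}.Finite := by
    apply (hD.image Prod.fst).subset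
    rintro i ⟨j, hj⟩
    exact ⟨_, hj, rfl⟩
  have hsub : {i : ℕ | ∃ j, (i, j) ∈ D} ⊆
      {i : ℕ | (∃ j, (i, j) ∈ D) ∧ ¬∃ j, (i, j) ∈ D ∧ (i + 1, j) ∈ D} ∪
      {i : ℕ | ∃ j, (i, j) ∈ D ∧ (i+1, j) ∈ D} := by
    intro i hi
    by_cases h : ∃ j, (i, j) ∈ D ∧ (i + 1, j) ∈ D
    · exact Or.inr h
    · exact Or.inl ⟨hi, h⟩
  have h1 := Set.ncard_le_ncard hsub ((hrow.subset (fun i hi => hi.1)).union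
    (hrow.subset (fun i ⟨j, hj⟩ => ⟨j, hj.1⟩)))
  have h2 := Set.ncard_union_le
    {i : ℕ | (∃ j, (i, j) ∈ D) ∧ ¬∃ j, (i, j) ∈ D ∧ (i + 1, j) ∈ D}
    {i : ℕ | ∃ j, (i, j) ∈ D ∧ (i+1, j) ∈ D}
  omega

lemma link_le (D : Set Cell) (hD : D.Finite) :
    {i : ℕ | ∃ j, (i, j) ∈ D ∧ (i+1, j) ∈ D}.ncard + (Prod.snd '' D).ncard ≤ D.ncard := by
  set E : Set Cell := {x | x ∈ D ∧ (x.1 + 1, x.2) ∈ D} with hE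
  have hEf : E.Finite := hD.subset (fun x hx => hx.1)
  have h1 : {i : ℕ | ∃ j, (i, j) ∈ D ∧ (i+1, j) ∈ D}.ncard ≤ E.ncard := by
    have : {i : ℕ | ∃ j, (i, j) ∈ D ∧ (i+1, j) ∈ D} = Prod.fst '' E := by
      ext i
      constructor
      · rintro ⟨j, hj⟩
        exact ⟨(i, j), hj, rfl⟩
      · rintro ⟨⟨a, b⟩, hx, rfl⟩
        exact ⟨b, hx⟩
    rw [this]
    exact Set.ncard_image_le hEf
  have h2 : (Prod.snd '' D).ncard ≤ (D \ E).ncard := by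
    have hs : Prod.snd '' D ⊆ Prod.snd '' (D \ E) := by
      rintro _ ⟨⟨a, j⟩, hx, rfl⟩
      obtain ⟨M, hM⟩ := (hD.image Prod.fst).bddAbove
      have hne : ∃ i, (a + i, j) ∉ D := ⟨M + 1, fun h => by
        have := hM ⟨_, h, rfl⟩
        simp at this
        omega⟩
      have h0 : Nat.find hne ≠ 0 := by
        intro h0
        have := Nat.find_spec hne
        rw [h0] at this
        exact this hx
      have h3 := Nat.find_min hne (show Nat.find hne - 1 < Nat.find hne by omega)
      have h4 := Nat.find_spec hne
      refine ⟨(a + (Nat.find hne - 1), j), ⟨not_not.1 h3, ?_⟩, rfl⟩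
      rintro ⟨-, h5⟩
      simp only at h5
      rw [show a + (Nat.find hne - 1) + 1 = a + Nat.find hne by omega] at h5
      exact h4 h5
    exact (Set.ncard_le_ncard hs ((hD.subset Set.diff_subset).image _)).trans
      (Set.ncard_image_le (hD.subset Set.diff_subset))
  have h3 := Set.ncard_diff_add_ncard_of_subset (s := E) (t := D) (fun x hx => hx.1) hD
  omega

theorem statement16 (k : ℕ) (hk : 1 ≤ k) (lam : Set Cell) (hlam : IsBounded k lam)
    (u H V : Word k) (huHV : u = H ++ V) (hu : IsWeakHook k u)
    (hH : List.Chain' (fun a b => pos k (supp k u) b < pos k (supp k u) a) H)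
    (hV : List.Chain' (fun a b => pos k (supp k u) a < pos k (supp k u) b) V)
    (hmid : ∀ a ∈ H.getLast?, ∀ b ∈ V.head?, pos k (supp k u) a ≤ pos k (supp k u) b)
    (mu : Set Cell) (hmu : IsBounded k mu) (huact : starB k u lam = some mu) :
    htSkew (mu \ lam) ≤ V.length ∧
    ∀ vlam : Set Cell, starB k V lam = some vlam →
      htSkew (vlam \ lam) ≤ V.length - numSegments k (supp k u) V := by
  have hT : supp k u ≠ Finset.univ := by
    rcases hu with h | h
    · exact h.1
    · exact h.1
  have hHT : ∀ a ∈ H, a ∈ supp k u := by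
    intro a ha
    simp [supp, huHV, ha]
  have hVT : ∀ a ∈ V, a ∈ supp k u := by
    intro a ha
    simp [supp, huHV, ha]
  generalize supp k u = T at *
  have hH' : List.Pairwise (fun a b => pos k T b < pos k T a) H := by
    have : IsTrans (Idx k) (fun a b => pos k T b < pos k T a) := ⟨fun a b c h1 h2 => lt_trans h2 h1⟩
    exact List.isChain_iff_pairwise.1 hH
  have hV' : List.Pairwise (fun a b => pos k T a < pos k T b) V := by
    have : IsTrans (Idx k) (fun a b => pos k T a < pos k T b) := ⟨fun a b c h1 h2 => lt_trans h1 h2⟩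
    exact List.isChain_iff_pairwise.1 hV
  obtain ⟨hcore, hP0⟩ := pInv_spec k hk lam hlam
  obtain ⟨r0, m0, h0⟩ := core_rep k hcore
  set S0 := pInv k lam with hS0
  have huact' := huact
  unfold starB at huact'
  rw [Option.map_eq_some_iff] at huact'
  obtain ⟨S2, hS2, hmu2⟩ := huact'
  have happ : starCW k u (some (pInv k lam)) = starCW k H (starCW k V (some S0)) := by
    rw [huHV]
    unfold starCW
    rw [List.foldr_append]
  constructor
  · rw [happ] at hS2
    have hnone : ∀ W : Word k, starCW k W none = none := by
      intro W
      induction W with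
      | nil => rfl
      | cons a W ih =>
        show starC k a (starCW k W none) = none
        rw [ih]; rfl
    cases hS1 : starCW k V (some S0) with
    | none => rw [hS1, hnone] at hS2; simp at hS2
    | some S1 =>
      rw [hS1] at hS2
      obtain ⟨r1, m1, h1, hI1, -⟩ := runV k hk T hT S0 r0 m0 h0 V hVT hV' S1 hS1
      obtain ⟨r2, m2, h2, hI2, hinj⟩ := runH k hk T hT S1 r1 m1 h1 H hHT hH' S2 hS2
      rw [hP0] at hI1
      rw [hmu2] at hI2 hinj
      refine (ht_le _ (hmu.1.1.subset Set.diff_subset)).trans (le_trans ?_ hI1.card)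
      have hsub : {i : ℕ | ∃ j, (i, j) ∈ mu \ lam ∧ (i+1, j) ∈ mu \ lam} ⊆
          Prod.fst '' (pMap k S1 \ lam) := by
        rintro i ⟨j, hj1, hj2⟩
        refine ⟨(i, j), ⟨?_, hj1.2⟩, rfl⟩
        by_contra hn
        have hn' : (i+1, j) ∉ pMap k S1 := fun h' => hn (pMap_lower h1 (Nat.le_succ i) h')
        have := hinj ⟨hj1.1, hn⟩ ⟨hj2.1, hn'⟩ rfl
        simp at this
      exact (Set.ncard_le_ncard hsub (hI1.fin.image _)).trans (Set.ncard_image_le hI1.fin)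
  · intro vlam hv
    unfold starB at hv
    rw [Option.map_eq_some_iff] at hv
    obtain ⟨S1, hS1, rfl⟩ := hv
    obtain ⟨r1, m1, h1, hI1, hb⟩ := runV k hk T hT S0 r0 m0 h0 V hVT hV' S1 hS1
    rw [hP0] at hI1 hb
    have e1 := ht_le _ hI1.fin
    have e2 := link_le _ hI1.fin
    omega

end MN

end
end

section
/- Let u be a weak hook word that is not k-connected and in which the letter u_min occurs twice (once on each side of the hook form). Then the image of u in the nilCoxeter algebra 𝒩_k is zero, i.e. N_u = 0. -/
open scoped BigOperators Classical

noncomputable section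

namespace MN

theorem aux_valley (L R : List ℕ) (hL : L.Pairwise (· > ·)) (hR : R.Pairwise (· < ·))
    (x y : ℕ) (h : List.Sublist [x, y, x] (L ++ R)) : y < x := by
  rw [List.sublist_append_iff] at h
  obtain ⟨l1, l2, he, h1, h2⟩ := h
  have p1 := hL.sublist h1
  have p2 := hR.sublist h2
  rcases l1 with _ | ⟨a, _ | ⟨b, l1⟩⟩
  · simp at he
    subst he
    simp at p2
  · simp at he
    obtain ⟨rfl, he⟩ := he
    subst he
    simpa using p2
  · simp at he
    obtain ⟨rfl, rfl, he⟩ := he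
    simp at p1
    exact p1.1.1

theorem aux_hook (k : ℕ) (u : Word k) (hu : IsWeakHook k u) :
    supp k u ≠ Finset.univ ∧ ∃ L R : List ℕ, posList k u = L ++ R ∧
      L.Pairwise (· > ·) ∧ R.Pairwise (· < ·) := by
  rcases hu with ⟨h, ds, as, v, e, h1, h2⟩ | ⟨h, ds, as, v, e, h1, h2⟩
  · refine ⟨h, ds ++ [v], as, by simp [e], List.isChain_iff_pairwise.1 h1, ?_⟩
    exact (List.pairwise_cons.1 (List.isChain_iff_pairwise.1 h2)).2
  · exact ⟨h, ds ++ [v], v :: as, by simp [e], List.isChain_iff_pairwise.1 h1,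
      List.isChain_iff_pairwise.1 h2⟩

theorem aux_gap (k : ℕ) (S : Finset (Idx k)) (h : S ≠ Finset.univ) : gap k S ∉ S := by
  have hex : ∃ m : ℕ, m ≤ k ∧ (m : Idx k) ∉ S := by
    by_contra hc
    push Not at hc
    apply h
    ext x
    simp only [Finset.mem_univ, iff_true]
    have := hc x.val (Nat.lt_succ_iff.1 (ZMod.val_lt x))
    simpa using this
  unfold gap gapNat
  rw [dif_pos hex]
  exact (Nat.find_spec hex).2

theorem aux_comm (k : ℕ) (i j : Idx k) (h1 : i - j ≠ 1) (h2 : j - i ≠ 1) :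
    Commute (Ngen k i) (Ngen k j) := by
  have := RingQuot.mkAlgHom_rel ℤ (NkRel.comm i j h1 h2)
  simpa [Commute, SemiconjBy, Ngen] using this

theorem aux_sq (k : ℕ) (i : Idx k) : Ngen k i * Ngen k i = 0 := by
  have := RingQuot.mkAlgHom_rel ℤ (NkRel.sq i)
  simpa [Ngen] using this

theorem aux_split (k : ℕ) (u : Word k) (c : Idx k) (h : u.count c = 2) :
    ∃ p m r : Word k, u = p ++ c :: (m ++ c :: r) := by
  have hc : c ∈ u := List.count_pos_iff.1 (by omega)
  obtain ⟨p, q, e, hp⟩ := List.eq_append_cons_of_mem hc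
  have hq : c ∈ q := by
    apply List.count_pos_iff.1
    rw [e, List.count_append, List.count_cons_self, List.count_eq_zero_of_not_mem hp] at h
    omega
  obtain ⟨m, r, e2, -⟩ := List.eq_append_cons_of_mem hq
  exact ⟨p, m, r, by rw [e, e2]⟩

theorem aux_pos (k : ℕ) (hk : 1 ≤ k) (S : Finset (Idx k)) (a b : Idx k) (h : b - a = 1)
    (ha : a ≠ gap k S) : pos k S b = pos k S a + 1 := by
  haveI : Fact (1 < k + 1) := ⟨by omega⟩
  have e : b - gap k S - 1 = (a - gap k S - 1) + 1 := by
    rw [← h]; ring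
  have hlt := ZMod.val_lt (a - gap k S - 1)
  have hne : (a - gap k S - 1).val ≠ k := by
    intro hv
    apply ha
    have h3 : ((k : ℕ) : ZMod (k + 1)) = a - gap k S - 1 := by
      have h5 := congrArg (Nat.cast : ℕ → ZMod (k + 1)) hv
      rw [← h5]; simp
    have h4 : ((k : ℕ) : ZMod (k + 1)) + 1 = 0 := by
      exact_mod_cast ZMod.natCast_self (k + 1)
    rw [h3] at h4
    have : a - gap k S = 0 := by rw [← h4]; ring
    exact sub_eq_zero.1 this
  unfold pos
  rw [e, ZMod.val_add_of_lt, ZMod.val_one]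
  rw [ZMod.val_one]
  omega

theorem aux_pos' (k : ℕ) (S : Finset (Idx k)) (a b : Idx k)
    (h : pos k S b = pos k S a + 1) : a + 1 = b := by
  unfold pos at h
  have := congrArg (Nat.cast : ℕ → ZMod (k + 1)) h
  simp at this
  rw [← sub_eq_zero] at this ⊢
  rw [← neg_eq_zero, ← this]; ring

theorem statement17 (k : ℕ) (hk : 1 ≤ k) (u : Word k) (hu : IsWeakHook k u)
    (hnc : ¬IsKConnected k u) (h2 : uminCount k u = 2)
    (hL : OnLeftSide k u (umin k u)) (hR : OnRightSide k u (umin k u)) :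
    Nword k u = 0 := by
  have hne : (uminCands k u).Nonempty := by
    by_contra hc
    simp [uminCount, hc] at h2
  have hcount : u.count (umin k u) = 2 := by
    simpa [uminCount, hne] using h2
  have hmem : umin k u ∈ uminCands k u := by
    unfold umin
    rw [dif_pos hne]
    exact ((uminCands k u).exists_min_image (pos k (supp k u)) hne).choose_spec.1
  generalize umin k u = c at hmem hcount
  obtain ⟨hcS, a, haS, hac, hac1, hb⟩ := Finset.mem_filter.1 hmem
  obtain ⟨hS, L, R, hLR, pL, pR⟩ := aux_hook k u hu
  have hg := aux_gap k _ hS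
  obtain ⟨p, m, r, e⟩ := aux_split k u c hcount
  have hcomm : ∀ b ∈ m, Commute (Ngen k c) (Ngen k b) := by
    intro b hbm
    have hbS : b ∈ supp k u := by
      simp [supp, e, hbm]
    have hsub : List.Sublist [c, b, c] u := by
      rw [e]
      apply List.Sublist.trans _ (List.sublist_append_right p _)
      apply List.Sublist.cons_cons
      exact List.Sublist.append (l₁ := [b]) (List.singleton_sublist.2 hbm)
        (List.Sublist.cons_cons c (List.nil_sublist r))
    have hlt : pos k (supp k u) b < pos k (supp k u) c := by
      apply aux_valley L R pL pR
      rw [← hLR]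
      exact hsub.map (pos k (supp k u))
    have h3 := hb b hbS
    have h4 : pos k (supp k u) c ≠ pos k (supp k u) a + 1 :=
      fun h => hac1 (aux_pos' k _ a c h)
    apply aux_comm
    · intro h
      have := aux_pos k hk (supp k u) b c h (fun h => hg (h ▸ hbS))
      omega
    · intro h
      have := aux_pos k hk (supp k u) c b h (fun h => hg (h ▸ hcS))
      omega
  have hprod : Commute (Ngen k c) (m.map (Ngen k)).prod := by
    apply Commute.list_prod_right
    intro x hx
    obtain ⟨b, hbm, rfl⟩ := List.mem_map.1 hx
    exact hcomm b hbm
  unfold Nword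
  rw [e]
  simp only [List.map_append, List.map_cons, List.prod_append, List.prod_cons]
  rw [← mul_assoc (Ngen k c), hprod.eq, mul_assoc _ (Ngen k c),
    ← mul_assoc (Ngen k c), aux_sq]
  simp

end MN

end
end
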